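/- Suppose the triple (a, b, c) ∈ F_q³ satisfies a ≠ 0 and b² − 4ac ≠ 0, and suppose e is a divisor of q − 1 (with e even if q is odd). Then N(e, e) ≥ θ(e)²·( q − 2·W(e)·√q·( W(e) − 3/2 + 1/(2·W(e)) ) − 3·W(e) ). -/

import Mathlib

/-- `g` is `e`-free: `g ≠ 0` and whenever `g = h^d` with `d ∣ e`, we have `d = 1`. -/
def EFree {F : Type*} [Field F] [Fintype F] (e : ℕ) (g : F) : Prop :=
  g ≠ 0 ∧ ∀ d : ℕ, d ∣ e → (∃ h : F, g = h ^ d) → d = 1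

/-- `N(e₁, e₂)`: the number of `g ∈ F_q^×` such that `g` is `e₁`-free and
`a·g² + b·g + c` is `e₂`-free. -/
noncomputable def NN {F : Type*} [Field F] [Fintype F] (a b c : F) (e₁ e₂ : ℕ) : ℕ :=
  Set.ncard {g : F | EFree e₁ g ∧ EFree e₂ (a * g ^ 2 + b * g + c)}

/-- `W(m) = 2^{ω(m)}`, where `ω(m)` is the number of distinct prime divisors of `m`. -/
def W (m : ℕ) : ℕ := 2 ^ m.primeFactors.card

/-- `θ(m) = ∏_{p ∣ m, p prime} (1 − 1/p)`. -/
noncomputable def θ (m : ℕ) : ℝ := ∏ p ∈ m.primeFactors, (1 - 1 / (p : ℝ))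

open Polynomial

section Stepanov

variable {K : Type*} [Field K]

/-- The linear map sending `X ^ n` to `X ^ (n - r)` if `n ≡ r` modulo `M`, and to `0` otherwise. -/
noncomputable def residuePart (M r : ℕ) : K[X] →ₗ[K] K[X] :=
  Polynomial.lsum fun n => if n % M = r then Polynomial.monomial (n - r) else 0

lemma residuePart_monomial (M r n : ℕ) (c : K) :
    residuePart M r (monomial n c) = if n % M = r then monomial (n - r) c else 0 := by
  rw [residuePart, lsum_apply, sum_monomial_index _ _ (by simp)]
  split_ifs <;> simp

lemma natDegree_residuePart_le (M r : ℕ) (h : K[X]) :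
    (residuePart M r h).natDegree ≤ h.natDegree := by
  rw [residuePart, lsum_apply, Polynomial.sum_def]
  refine natDegree_sum_le_of_forall_le _ _ fun i hi => ?_
  have := le_natDegree_of_mem_supp i hi
  split_ifs
  · exact (natDegree_monomial_le _).trans (by omega)
  · simp

lemma dvd_sub_sum_residuePart {M : ℕ} (hM : 0 < M) (s : K) (h : K[X]) :
    X ^ M - C (s ^ M) ∣
      h - ∑ r ∈ Finset.range M, C ((residuePart M r h).eval s) * X ^ r := by
  induction h using Polynomial.induction_on' with
  | add f g hf hg =>
    convert dvd_add hf hg using 1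
    simp only [map_add, eval_add, add_mul, Finset.sum_add_distrib]
    ring
  | monomial n c =>
    rw [Finset.sum_eq_single (n % M)]
    · rw [residuePart_monomial, if_pos rfl, eval_monomial]
      have h1 : n - n % M = M * (n / M) := by have := Nat.mod_add_div n M; omega
      have h2 : (monomial n c : K[X]) = C c * ((X ^ M) ^ (n / M) * X ^ (n % M)) := by
        rw [← pow_mul, ← pow_add, Nat.div_add_mod, C_mul_X_pow_eq_monomial]
      rw [h1, h2, pow_mul, C_mul, C_pow, C_pow]
      have := sub_dvd_pow_sub_pow (X ^ M : K[X]) (C s ^ M) (n / M)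
      rw [C_pow]
      convert this.mul_left (C c * X ^ (n % M)) using 1
      ring
    · intro r _ hr
      rw [residuePart_monomial, if_neg (Ne.symm hr)]
      simp
    · intro h
      exact absurd (Finset.mem_range.2 (Nat.mod_lt _ hM)) h

lemma dvd_pow_sub_C_eval_pow {p k : ℕ} [Fact p.Prime] [CharP K p] (s : K) (g : K[X]) :
    (X - C s) ^ p ^ k ∣ g ^ p ^ k - C (g.eval s ^ p ^ k) := by
  rw [C_pow, ← sub_pow_char_pow]
  exact pow_dvd_pow_of_dvd (X_sub_C_dvd_sub_C_eval) _

/-- Powers of `f`, twisted by powers of `X ^ Q`, are independent over polynomials of small degree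
as soon as `f` has a simple zero at the origin. -/
lemma sum_mul_pow_ne_zero {d B D : ℕ} {f f₁ : K[X]} (hf : f = X * f₁)
    (hf₁ : f₁.eval 0 ≠ 0) (κ : Fin d × Fin B → K[X])
    (hκ : ∀ x, (κ x).degree < D) (h0 : κ ≠ 0) :
    ∑ x, κ x * X ^ ((d * D + 1) * (x.2 : ℕ)) * f ^ ((x.1 : ℕ) * D) ≠ 0 := by
  classical
  intro hsum
  let N : Fin d × Fin B → ℕ := fun x => (d * D + 1) * (x.2 : ℕ) + (x.1 : ℕ) * D
  obtain ⟨x₀, hx₀, hmin⟩ := Finset.exists_min_image (Finset.univ.filter fun x => κ x ≠ 0) N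
    (by obtain ⟨x, hx⟩ := Function.ne_iff.1 h0
        exact ⟨x, by simpa using hx⟩)
  simp only [Finset.mem_filter, Finset.mem_univ, true_and] at hx₀ hmin
  have hD : 0 < D := by
    by_contra h
    have : D = 0 := by omega
    have h1 := hκ x₀
    rw [this] at h1
    exact hx₀ (by simpa using h1)
  have hgap : ∀ x, x ≠ x₀ → N x₀ ≤ N x → N x₀ + D ≤ N x := by
    rintro ⟨j, k⟩ hne hle
    obtain ⟨⟨j₀, k₀⟩, rfl⟩ : ∃ y, y = x₀ := ⟨_, rfl⟩
    simp only [N] at hle ⊢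
    have hj := j.2
    have hj₀ := j₀.2
    have a1 : (j : ℕ) * D + D ≤ d * D := by nlinarith
    have a2 : (j₀ : ℕ) * D + D ≤ d * D := by nlinarith
    rcases lt_trichotomy (k : ℕ) k₀ with h | h | h
    · have : (d * D + 1) * (k : ℕ) + (d * D + 1) ≤ (d * D + 1) * k₀ := by
        simpa [Nat.mul_succ] using Nat.mul_le_mul_left (d * D + 1) h
      omega
    · have hk : k = k₀ := Fin.ext h
      subst hk
      have hjj : (j : ℕ) ≠ j₀ := fun h => hne (by rw [Fin.ext h])
      have : (j₀ : ℕ) < j := by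
        by_contra hc
        have : (j : ℕ) < j₀ := by omega
        have : (j : ℕ) * D + D ≤ j₀ * D := by nlinarith
        omega
      nlinarith
    · have : (d * D + 1) * (k₀ : ℕ) + (d * D + 1) ≤ (d * D + 1) * k := by
        simpa [Nat.mul_succ] using Nat.mul_le_mul_left (d * D + 1) h
      omega
  have hterm : ∀ x, κ x * X ^ ((d * D + 1) * (x.2 : ℕ)) * f ^ ((x.1 : ℕ) * D)
      = X ^ N x * (κ x * f₁ ^ ((x.1 : ℕ) * D)) := by
    intro x
    rw [hf, mul_pow]
    simp only [N]
    ring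
  simp_rw [hterm] at hsum
  rw [← Finset.add_sum_erase _ _ (Finset.mem_univ x₀)] at hsum
  have hdvd : (X : K[X]) ^ (N x₀ + D) ∣
      ∑ x ∈ Finset.univ.erase x₀, X ^ N x * (κ x * f₁ ^ ((x.1 : ℕ) * D)) := by
    refine Finset.dvd_sum fun x hx => ?_
    by_cases hz : κ x = 0
    · simp [hz]
    · exact (pow_dvd_pow _ (hgap x (Finset.ne_of_mem_erase hx) (hmin x hz))).mul_right _
  have hdvd2 : (X : K[X]) ^ (N x₀ + D) ∣ X ^ N x₀ * (κ x₀ * f₁ ^ ((x₀.1 : ℕ) * D)) := by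
    rw [eq_neg_of_add_eq_zero_left hsum]
    exact (dvd_neg).2 hdvd
  rw [pow_add] at hdvd2
  have h3 := (mul_dvd_mul_iff_left (pow_ne_zero _ X_ne_zero)).1 hdvd2
  have hcop : IsCoprime ((X : K[X]) ^ D) (f₁ ^ ((x₀.1 : ℕ) * D)) := by
    refine IsCoprime.pow ?_
    refine (irreducible_X.coprime_iff_not_dvd).2 ?_
    rw [X_dvd_iff, coeff_zero_eq_eval_zero]
    exact hf₁
  have h4 := hcop.dvd_of_dvd_mul_right h3
  have := degree_le_of_dvd h4 hx₀
  rw [degree_X_pow] at this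
  exact absurd (hκ x₀) (not_lt.2 this)

/-- Stepanov's bound for the number of solutions of `s ^ Q = s + δ` with `f` in a given coset of
the `d`-th powers, where `Q = M ^ 2` and `f` has a simple zero at the origin. -/
theorem stepanov_card_le {p l d E m : ℕ} [Fact p.Prime] [CharP K p] (hd : 2 ≤ d) (hE : 0 < E)
    (hM : p ^ l = d * E + 1) {f f₁ : K[X]} (hf : f = X * f₁) (hf₁ : f₁.eval 0 ≠ 0)
    (hm : f.natDegree ≤ m) (δ v : K) (hv : v ≠ 0) (Z : Finset K)
    (hZ : ∀ s ∈ Z, s ^ (p ^ l) ^ 2 = s + δ ∧ f.eval s ^ (E * (p ^ l + 1)) = v) :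
    d * Z.card ≤ (p ^ l) ^ 2 + d * (4 * m + 8) * p ^ l := by
  classical
  obtain ⟨M, hMdef⟩ : ∃ M, M = p ^ l := ⟨_, rfl⟩
  rw [← hMdef] at hM hZ ⊢
  have hMpos : 0 < M := by omega
  obtain ⟨D, hD⟩ : ∃ D, D = E * (M + 1) := ⟨_, rfl⟩
  have hDpos : 0 < D := by rw [hD]; positivity
  have hQ : M ^ 2 = d * D + 1 := by rw [hD, hM]; ring
  obtain ⟨B, hB⟩ : ∃ B, B = E + (2 * m + 4) := ⟨_, rfl⟩
  obtain ⟨L, hL⟩ : ∃ L, L = D + B + (d - 1) * m * E := ⟨_, rfl⟩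
  rw [← hD] at hZ
  let ι := (Fin d × Fin B) × Fin D
  let T₀ : ι → ℕ → K[X] := fun x r =>
    (X + C δ) ^ (x.1.2 : ℕ) * C (v ^ (x.1.1 : ℕ)) * f ^ ((d - 1 - x.1.1) * E) *
      residuePart M r (X ^ (x.2 : ℕ) * f ^ ((x.1.1 : ℕ) * E))
  have hT₀ : ∀ x r, T₀ x r ∈ degreeLT K L := by
    rintro ⟨⟨j, k⟩, i⟩ r
    have hj := j.2
    have hk := k.2
    have hi := i.2
    rw [mem_degreeLT]
    refine lt_of_le_of_lt degree_le_natDegree ?_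
    refine Nat.cast_lt.2 ?_
    have e1 : ((X + C δ : K[X]) ^ (k : ℕ)).natDegree ≤ k := by
      refine natDegree_pow_le.trans ?_
      rw [natDegree_X_add_C, mul_one]
    have e2 : (f ^ ((d - 1 - j) * E)).natDegree ≤ (d - 1 - j) * E * m :=
      natDegree_pow_le_of_le _ hm
    have e3 : (residuePart M r (X ^ (i : ℕ) * f ^ ((j : ℕ) * E))).natDegree
        ≤ i + (j : ℕ) * E * m := by
      refine (natDegree_residuePart_le _ _ _).trans (natDegree_mul_le.trans ?_)
      exact add_le_add (natDegree_X_pow_le _) (natDegree_pow_le_of_le _ hm)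
    have e4 : (T₀ ((j, k), i) r).natDegree ≤
        k + 0 + (d - 1 - j) * E * m + (i + (j : ℕ) * E * m) :=
      natDegree_mul_le.trans (add_le_add (natDegree_mul_le.trans (add_le_add
        (natDegree_mul_le.trans (add_le_add e1 (natDegree_C _).le)) e2)) e3)
    have e5 : (d - 1 - j) * E * m + (j : ℕ) * E * m = (d - 1) * m * E := by
      obtain ⟨t, ht⟩ : ∃ t, d - 1 = j + t := ⟨d - 1 - j, by omega⟩
      rw [ht, Nat.add_sub_cancel_left]
      ring
    omega
  let T : (ι → K) →ₗ[K] (Fin M → degreeLT K L) :=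
    LinearMap.pi fun r => Fintype.linearCombination K fun x => (⟨T₀ x r, hT₀ x r⟩ : degreeLT K L)
  have hdim : Module.finrank K (Fin M → degreeLT K L) < Module.finrank K (ι → K) := by
    rw [Module.finrank_pi_fintype, Module.finrank_fintype_fun_eq_card,
      (degreeLTEquiv K L).finrank_eq]
    simp only [Module.finrank_fintype_fun_eq_card, Fintype.card_fin, Finset.sum_const,
      Finset.card_univ, smul_eq_mul, ι, Fintype.card_prod]
    have hd1 : ∃ t, d = t + 2 := ⟨d - 2, by omega⟩
    obtain ⟨t, rfl⟩ := hd1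
    have : t + 2 - 1 = t + 1 := rfl
    rw [hL, hB, this]
    have key : M * (D + (E + (2 * m + 4)) + (t + 1) * m * E) < (t + 2) * (E + (2 * m + 4)) * D := by
      rw [hD, hM]
      obtain ⟨E', rfl⟩ : ∃ E', E = E' + 1 := ⟨E - 1, by omega⟩
      ring_nf
      nlinarith [Nat.zero_le (m * t * E')]
    exact key
  obtain ⟨w, hw0, hw⟩ : ∃ w, w ≠ 0 ∧ T w = 0 := by
    obtain ⟨w, hw, hw0⟩ := (Submodule.ne_bot_iff _).1 (LinearMap.ker_ne_bot_of_finrank_lt hdim)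
    exact ⟨w, hw0, hw⟩
  have hTw : ∀ r < M, ∑ x, C (w x) * T₀ x r = 0 := by
    intro r hr
    have := congrArg (fun y => ((y ⟨r, hr⟩ : degreeLT K L) : K[X])) hw
    simpa [T, Fintype.linearCombination_apply, smul_eq_C_mul] using this
  let κ : Fin d × Fin B → K[X] := fun y => ∑ i : Fin D, C (w (y, i)) * X ^ (i : ℕ)
  have hκ : ∀ y, (κ y).degree < D := fun y => by
    refine (degree_sum_le _ _).trans_lt ((Finset.sup_lt_iff (WithBot.bot_lt_coe D)).2 fun i _ => ?_)
    exact (degree_C_mul_X_pow_le _ _).trans_lt (Nat.cast_lt.2 i.2)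
  have hκ0 : κ ≠ 0 := by
    intro h
    apply hw0
    funext ⟨y, i⟩
    have := congrArg (fun g => (g y).coeff i) h
    simpa [κ, coeff_X_pow, Fin.val_inj] using this
  set P : K[X] := ∑ y, κ y * X ^ ((d * D + 1) * (y.2 : ℕ)) * f ^ ((y.1 : ℕ) * D) with hP
  have hP0 : P ≠ 0 := sum_mul_pow_ne_zero hf hf₁ κ hκ hκ0
  have hPdeg : P.natDegree ≤ M ^ 2 * (B + m) := by
    refine natDegree_sum_le_of_forall_le _ _ fun y _ => ?_
    have e1 : (κ y).natDegree ≤ D := natDegree_le_of_degree_le (hκ y).le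
    have e2 : (f ^ ((y.1 : ℕ) * D)).natDegree ≤ (y.1 : ℕ) * D * m := natDegree_pow_le_of_le _ hm
    refine (natDegree_mul_le.trans (add_le_add (natDegree_mul_le.trans
      (add_le_add e1 (natDegree_X_pow_le _))) e2)).trans ?_
    have hj := y.1.2
    have hk := y.2.2
    rw [hQ]
    have a1 : (y.1 : ℕ) * D * m ≤ d * D * m := by gcongr
    have a2 : (d * D + 1) * (y.2 : ℕ) + (d * D + 1) ≤ (d * D + 1) * B := by
      simpa [Nat.mul_succ] using Nat.mul_le_mul_left (d * D + 1) hk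
    have a3 : D ≤ d * D := by nlinarith
    nlinarith
  have hdvd : ∀ s ∈ Z, (X - C s) ^ M ∣ P := by
    intro s hs
    obtain ⟨hs1, hs2⟩ := hZ s hs
    have hfs : f.eval s ≠ 0 := by
      intro h
      rw [h, zero_pow hDpos.ne'] at hs2
      exact hv hs2.symm
    have hXM : (X - C s : K[X]) ^ M = X ^ M - C (s ^ M) := by
      rw [hMdef, sub_pow_char_pow, C_pow]
    have hterm : ∀ x : ι, (X - C s) ^ M ∣
        C (f.eval s ^ ((d - 1) * E)) * ((C (w x) * X ^ (x.2 : ℕ)) *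
          X ^ ((d * D + 1) * (x.1.2 : ℕ)) * f ^ ((x.1.1 : ℕ) * D)) -
        ∑ r ∈ Finset.range M, C ((C (w x) * T₀ x r).eval s) * X ^ r := by
      rintro ⟨⟨j, k⟩, i⟩
      have hj := j.2
      have h1 : X ^ ((d * D + 1) * (k : ℕ)) * f ^ ((j : ℕ) * D) =
          (X ^ (M * (k : ℕ)) * f ^ ((j : ℕ) * E)) ^ M * f ^ ((j : ℕ) * E) := by
        rw [← hQ, hD, mul_pow, ← pow_mul, ← pow_mul, mul_assoc, ← pow_add]
        congr 2 <;> ring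
      have h2 := dvd_pow_sub_C_eval_pow (p := p) (k := l) s (X ^ (M * (k : ℕ)) * f ^ ((j : ℕ) * E))
      rw [← hMdef] at h2
      have h3 := dvd_sub_sum_residuePart hMpos s (X ^ (i : ℕ) * f ^ ((j : ℕ) * E))
      rw [← hXM] at h3
      have h4 : f.eval s ^ ((d - 1) * E) *
          (X ^ (M * (k : ℕ)) * f ^ ((j : ℕ) * E)).eval s ^ M =
          (s + δ) ^ (k : ℕ) * v ^ (j : ℕ) * f.eval s ^ ((d - 1 - j) * E) := by
        rw [← hs1, ← hs2]
        simp only [eval_mul, eval_pow, eval_X]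
        obtain ⟨t, ht⟩ : ∃ t, d - 1 = j + t := ⟨d - 1 - j, by omega⟩
        rw [ht, Nat.add_sub_cancel_left, hD]
        ring
      have h5 : ∑ r ∈ Finset.range M, C ((C (w ((j, k), i)) * T₀ ((j, k), i) r).eval s) * X ^ r =
          C (w ((j, k), i)) * C ((s + δ) ^ (k : ℕ) * v ^ (j : ℕ) *
            f.eval s ^ ((d - 1 - j) * E)) *
          ∑ r ∈ Finset.range M,
            C ((residuePart M r (X ^ (i : ℕ) * f ^ ((j : ℕ) * E))).eval s) * X ^ r := by
        rw [Finset.mul_sum]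
        refine Finset.sum_congr rfl fun r _ => ?_
        simp only [T₀, eval_mul, eval_pow, eval_add, eval_X, eval_C, C_mul]
        ring
      rw [h5, ← h4]
      have h6 := (h2.mul_left (C (f.eval s ^ ((d - 1) * E)) * (C (w ((j, k), i)) *
        (X ^ (i : ℕ) * f ^ ((j : ℕ) * E))))).add (h3.mul_left (C (w ((j, k), i)) *
          C (f.eval s ^ ((d - 1) * E) *
          (X ^ (M * (k : ℕ)) * f ^ ((j : ℕ) * E)).eval s ^ M)))
      convert h6 using 1
      have h7 : C (w ((j, k), i)) * X ^ (i : ℕ) * X ^ ((d * D + 1) * (k : ℕ)) * f ^ ((j : ℕ) * D) =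
          C (w ((j, k), i)) * X ^ (i : ℕ) *
            ((X ^ (M * (k : ℕ)) * f ^ ((j : ℕ) * E)) ^ M * f ^ ((j : ℕ) * E)) := by
        rw [← h1]; ring
      simp only [h7, C_mul]
      ring
    have hsum := Finset.dvd_sum fun x (_ : x ∈ Finset.univ) => hterm x
    rw [Finset.sum_sub_distrib, Finset.sum_comm, ← Finset.mul_sum] at hsum
    have hz : ∑ r ∈ Finset.range M, ∑ x, C ((C (w x) * T₀ x r).eval s) * X ^ r = 0 := by
      refine Finset.sum_eq_zero fun r hr => ?_
      rw [← Finset.sum_mul, ← map_sum, ← eval_finsetSum, hTw r (Finset.mem_range.1 hr)]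
      simp
    rw [hz, sub_zero] at hsum
    have hPe : ∑ x : ι, (C (w x) * X ^ (x.2 : ℕ)) *
          X ^ ((d * D + 1) * (x.1.2 : ℕ)) * f ^ ((x.1.1 : ℕ) * D) = P := by
      rw [hP, Fintype.sum_prod_type]
      refine Finset.sum_congr rfl fun y _ => ?_
      simp only [κ, Finset.sum_mul]
    rw [hPe] at hsum
    exact ((isUnit_C.2 (pow_ne_zero _ hfs).isUnit).dvd_mul_left).1 hsum
  have hprod : ∏ s ∈ Z, (X - C s) ^ M ∣ P := by
    refine Finset.prod_dvd_of_coprime (fun a _ b _ hab => ?_) hdvd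
    exact (pairwise_coprime_X_sub_C Function.injective_id hab).pow
  have hcard := natDegree_le_of_dvd hprod hP0
  rw [Finset.prod_pow, natDegree_pow,
    natDegree_prod_of_monic _ _ fun s _ => monic_X_sub_C s] at hcard
  simp only [natDegree_X_sub_C, Finset.sum_const, smul_eq_mul, mul_one] at hcard
  have h1 : M * Z.card ≤ M * (M * (B + m)) := by
    calc _ ≤ _ := hcard.trans hPdeg
      _ = _ := by ring
  have h2 := Nat.le_of_mul_le_mul_left h1 hMpos
  calc d * Z.card ≤ d * (M * (B + m)) := by gcongr
    _ = M * (d * E) + d * (3 * m + 4) * M := by rw [hB]; ring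
    _ ≤ M * M + d * (4 * m + 8) * M := by
      gcongr <;> omega
    _ = _ := by ring

end Stepanov

section ExtensionSums

variable {F L : Type*} [Field F] [Fintype F] [Field L] [Fintype L] [Algebra F L]

lemma norm_mulChar_le_one (ψ : MulChar F ℂ) (v : F) : ‖ψ v‖ ≤ 1 := by
  classical
  by_cases hv : v = 0
  · simp [hv, MulChar.map_zero]
  · refine le_of_eq ?_
    exact Complex.norm_eq_one_of_mem_rootsOfUnity (ψ.apply_mem_rootsOfUnity (Units.mk0 v hv))

lemma two_le_card_sub_one_of_mulChar_ne_one {ψ : MulChar F ℂ} (hψ : ψ ≠ 1) :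
    2 ≤ Fintype.card F - 1 := by
  classical
  by_contra h
  apply hψ
  ext a
  have h1 : Fintype.card Fˣ ≤ 1 := by
    rw [Fintype.card_units]; omega
  have := Fintype.card_le_one_iff.1 h1 a 1
  simp [this]

lemma card_filter_norm_eval_le {n m : ℕ} (hn : 0 < n)
    (hcard : Fintype.card L = (Fintype.card F ^ n) ^ 2) (hd : 2 ≤ Fintype.card F - 1)
    (f : L[X]) (hm : f.natDegree ≤ m) {ρ : AlgebraicClosure L}
    (hρ : aeval ρ f = 0) (hρ' : aeval ρ (derivative f) ≠ 0) [DecidableEq F] (v : F) (hv : v ≠ 0) :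
    (Fintype.card F - 1) * (Finset.univ.filter fun t : L => Algebra.norm F (f.eval t) = v).card ≤
      (Fintype.card F ^ n) ^ 2 +
        (Fintype.card F - 1) * (4 * m + 8) * Fintype.card F ^ n := by
  classical
  obtain ⟨p, hp⟩ := CharP.exists F
  have : CharP L p := charP_of_injective_algebraMap (algebraMap F L).injective p
  have : CharP (AlgebraicClosure L) p :=
    charP_of_injective_algebraMap (algebraMap L (AlgebraicClosure L)).injective p
  obtain ⟨k, hpp, hk⟩ := FiniteField.card F p
  have : Fact p.Prime := ⟨hpp⟩
  have hM : Fintype.card F ^ n = p ^ (k * n : ℕ) := by rw [hk, ← pow_mul]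
  have hq : Fintype.card F - 1 + 1 = Fintype.card F := by omega
  obtain ⟨d, hdef⟩ : ∃ d, d = Fintype.card F - 1 := ⟨_, rfl⟩
  rw [← hdef] at hd hq ⊢
  obtain ⟨E, hE⟩ : d ∣ Fintype.card F ^ n - 1 := by
    have := Nat.sub_dvd_pow_sub_pow (Fintype.card F) 1 n
    rwa [one_pow, ← hdef] at this
  have hMpos : Fintype.card F ≤ Fintype.card F ^ n := Nat.le_self_pow hn.ne' _
  have hE' : Fintype.card F ^ n = d * E + 1 := by omega
  have hEpos : 0 < E := by
    rcases Nat.eq_zero_or_pos E with h | h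
    · rw [h, mul_zero] at hE; omega
    · exact h
  set ι := algebraMap L (AlgebraicClosure L) with hι
  obtain ⟨h, hh⟩ : (X - C ρ) ∣ f.map ι := by
    rw [dvd_iff_isRoot, IsRoot, eval_map_algebraMap, hρ]
  have hg : (f.map ι).comp (X + C ρ) = X * h.comp (X + C ρ) := by
    rw [hh]; simp
  have hg1 : (h.comp (X + C ρ)).eval 0 ≠ 0 := by
    have h1 : aeval ρ (derivative f) = h.eval ρ := by
      rw [← eval_map_algebraMap, ← derivative_map, hh]
      simp
    rw [h1] at hρ'
    simpa using hρ'
  have hgdeg : ((f.map ι).comp (X + C ρ)).natDegree ≤ m := by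
    rw [natDegree_comp, natDegree_X_add_C, mul_one, natDegree_map]
    exact hm
  have hinj : Function.Injective fun t : L => ι t - ρ := fun a b hab =>
    ι.injective (sub_left_injective hab)
  have hv' : ι (algebraMap F L v) ≠ 0 := by simpa using hv
  have hindex : (Nat.card L - 1) / (Nat.card F - 1) = E * (Fintype.card F ^ n + 1) := by
    rw [Nat.card_eq_fintype_card, Nat.card_eq_fintype_card, hcard, ← hdef]
    apply Nat.div_eq_of_eq_mul_right (by omega)
    rw [hE', Nat.sub_eq_iff_eq_add (Nat.one_le_pow _ _ (by omega))]
    ring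
  have key := stepanov_card_le (p := p) (l := k * n) hd hEpos (hM ▸ hE') hg hg1 hgdeg
    (ρ - ρ ^ (Fintype.card F ^ n) ^ 2) _ hv'
    ((Finset.univ.filter fun t : L => Algebra.norm F (f.eval t) = v).image fun t => ι t - ρ) (by
      intro s hs
      obtain ⟨t, ht, rfl⟩ := Finset.mem_image.1 hs
      rw [Finset.mem_filter] at ht
      constructor
      · rw [← hM]
        have h2 : (Fintype.card F ^ n) ^ 2 = p ^ (k * n * 2 : ℕ) := by rw [hM, ← pow_mul]
        have h3 : t ^ (Fintype.card F ^ n) ^ 2 = t := by rw [← hcard, FiniteField.pow_card]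
        have h4 : (ι t - ρ) ^ (Fintype.card F ^ n) ^ 2 =
            ι t ^ (Fintype.card F ^ n) ^ 2 - ρ ^ (Fintype.card F ^ n) ^ 2 := by
          rw [h2, sub_pow_char_pow]
        rw [h4, ← map_pow, h3]
        ring
      · rw [← hM, ← ht.2, FiniteField.algebraMap_norm_eq_pow, hindex]
        simp [eval_comp, hι, aeval_algebraMap_apply_eq_algebraMap_eval])
  rwa [Finset.card_image_of_injective _ hinj, ← hM] at key

theorem norm_sum_mulChar_norm_eval_le {n m : ℕ} (hn : 0 < n)
    (hcard : Fintype.card L = (Fintype.card F ^ n) ^ 2) {ψ : MulChar F ℂ} (hψ : ψ ≠ 1)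
    (f : L[X]) (hm : f.natDegree ≤ m) {ρ : AlgebraicClosure L}
    (hρ : aeval ρ f = 0) (hρ' : aeval ρ (derivative f) ≠ 0) :
    ‖∑ t : L, ψ (Algebra.norm F (f.eval t))‖ ≤
      ((Fintype.card F - 1 : ℕ) * (4 * m + 8) + m : ℝ) * Fintype.card F ^ n := by
  classical
  have hd := two_le_card_sub_one_of_mulChar_ne_one hψ
  have hle := card_filter_norm_eval_le hn hcard hd f hm hρ hρ'
  obtain ⟨d, hdef⟩ : ∃ d, d = Fintype.card F - 1 := ⟨_, rfl⟩
  obtain ⟨M, hM⟩ : ∃ M, M = Fintype.card F ^ n := ⟨_, rfl⟩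
  have hMR : (M : ℝ) = Fintype.card F ^ n := by rw [hM]; push_cast; rfl
  rw [← hdef] at hle hd ⊢
  rw [← hM] at hle hcard
  rw [← hMR]
  have hM1 : 1 ≤ M := by rw [hM]; exact Nat.one_le_pow _ _ Fintype.card_pos
  let A : F → Finset L := fun v => Finset.univ.filter fun t : L => Algebra.norm F (f.eval t) = v
  have hf0 : f ≠ 0 := by rintro rfl; simp at hρ'
  have hA0 : (A 0).card ≤ m := by
    refine le_trans ?_ hm
    refine (Finset.card_le_card (t := f.roots.toFinset) fun t ht => ?_).trans
      ((Multiset.toFinset_card_le _).trans (card_roots' f))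
    rw [Finset.mem_filter, Algebra.norm_eq_zero_iff] at ht
    simpa [hf0] using ht.2
  have hsum : ∑ v, (A v).card = M ^ 2 := by
    rw [← hcard, ← Finset.card_univ]
    exact (Finset.card_eq_sum_card_fiberwise (fun _ _ => Finset.mem_univ _)).symm
  have hsum' : ∑ v ∈ Finset.univ.erase 0, ((A v).card : ℝ) = M ^ 2 - (A 0).card := by
    rw [eq_sub_iff_add_eq, add_comm,
      Finset.add_sum_erase _ (fun v => ((A v).card : ℝ)) (Finset.mem_univ 0)]
    exact_mod_cast hsum
  have hcard0 : ((Finset.univ.erase (0 : F)).card : ℝ) = d := by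
    rw [Finset.card_erase_of_mem (Finset.mem_univ _), Finset.card_univ, hdef]
  set c : ℝ := d * (4 * m + 8) with hc
  have hS : ∑ t : L, ψ (Algebra.norm F (f.eval t)) =
      ∑ v ∈ Finset.univ.erase 0, ψ v * (A v).card := by
    rw [← Finset.sum_fiberwise_of_maps_to (g := fun t => Algebra.norm F (f.eval t))
      (fun _ _ => Finset.mem_univ _), ← Finset.add_sum_erase _ _ (Finset.mem_univ 0)]
    rw [Finset.sum_congr (g := fun _ => (0 : ℂ)) rfl, Finset.sum_const_zero, zero_add]
    · refine Finset.sum_congr rfl fun v _ => ?_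
      rw [Finset.sum_congr (g := fun _ => ψ v) rfl, Finset.sum_const, nsmul_eq_mul, mul_comm]
      intro t ht
      rw [(Finset.mem_filter.1 ht).2]
    · intro t ht
      rw [(Finset.mem_filter.1 ht).2, MulChar.map_zero]
  have hψ0 : ∑ v ∈ Finset.univ.erase 0, ψ v = 0 := by
    rw [Finset.sum_erase _ (MulChar.map_zero ψ), MulChar.sum_eq_zero_of_ne_one hψ]
  have hd0 : (0 : ℝ) < d := by exact_mod_cast (by omega : 0 < d)
  have hb : ∀ v ∈ Finset.univ.erase (0 : F), 0 ≤ (M : ℝ) ^ 2 + c * M - d * (A v).card := by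
    intro v hv
    have := hle v (Finset.ne_of_mem_erase hv)
    rw [sub_nonneg, hc]
    exact_mod_cast this
  have h1 : (d : ℂ) * ∑ t : L, ψ (Algebra.norm F (f.eval t)) =
      - ∑ v ∈ Finset.univ.erase 0, ψ v * (((M : ℝ) ^ 2 + c * M - d * (A v).card : ℝ) : ℂ) := by
    have e : ∀ v, ψ v * (((M : ℝ) ^ 2 + c * M - d * (A v).card : ℝ) : ℂ) =
        ψ v * ((M : ℝ) ^ 2 + c * M : ℝ) - d * (ψ v * (A v).card) := by
      intro v; push_cast; ring
    simp_rw [e]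
    rw [Finset.sum_sub_distrib, ← Finset.sum_mul, hψ0, zero_mul, zero_sub, neg_neg,
      ← Finset.mul_sum, hS]
  have h2 : (d : ℝ) * ‖∑ t : L, ψ (Algebra.norm F (f.eval t))‖ ≤ d * ((c + m) * M) := by
    calc (d : ℝ) * ‖∑ t : L, ψ (Algebra.norm F (f.eval t))‖
        = ‖(d : ℂ) * ∑ t : L, ψ (Algebra.norm F (f.eval t))‖ := by
          rw [norm_mul]; simp
      _ ≤ ∑ v ∈ Finset.univ.erase 0, ‖ψ v * (((M : ℝ) ^ 2 + c * M - d * (A v).card : ℝ) : ℂ)‖ := by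
          rw [h1, norm_neg]
          exact norm_sum_le _ _
      _ ≤ ∑ v ∈ Finset.univ.erase 0, ((M : ℝ) ^ 2 + c * M - d * (A v).card) := by
          refine Finset.sum_le_sum fun v hv => ?_
          rw [norm_mul, Complex.norm_real, Real.norm_of_nonneg (hb v hv)]
          exact mul_le_of_le_one_left (hb v hv) (norm_mulChar_le_one ψ v)
      _ = d * (c * M + (A 0).card) := by
          rw [Finset.sum_sub_distrib, Finset.sum_const, nsmul_eq_mul, hcard0, ← Finset.mul_sum,
            hsum']
          ring
      _ ≤ d * ((c + m) * M) := by
          have : ((A 0).card : ℝ) ≤ m := by exact_mod_cast hA0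
          have h3 : (1 : ℝ) ≤ M := by exact_mod_cast hM1
          have : ((A 0).card : ℝ) ≤ m * M := by nlinarith [(Nat.cast_nonneg m : (0 : ℝ) ≤ m)]
          gcongr
          linarith
  exact le_of_mul_le_mul_left h2 hd0

end ExtensionSums

section QuadraticExtensionSums

lemma exists_ne_zero_root_quadratic {Ω : Type*} [Field Ω] [IsAlgClosed Ω] {a b c : Ω} (ha : a ≠ 0)
    (hdisc : b ^ 2 - 4 * a * c ≠ 0) : ∃ r : Ω, r ≠ 0 ∧ a * r ^ 2 + b * r + c = 0 := by
  by_cases hc : c = 0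
  · have hb : b ≠ 0 := by rintro rfl; simp [hc] at hdisc
    refine ⟨-b / a, div_ne_zero (neg_ne_zero.2 hb) ha, ?_⟩
    rw [hc]; field_simp; ring
  · obtain ⟨r, hr⟩ := IsAlgClosed.exists_root (C a * X ^ 2 + C b * X + C c)
      (by rw [degree_quadratic ha]; decide)
    have hr' : a * r ^ 2 + b * r + c = 0 := by simpa [IsRoot] using hr
    exact ⟨r, fun h => hc (by simpa [h] using hr'), hr'⟩

lemma exists_simple_root_quadratic_comp {L Ω : Type*} [Field L] [Field Ω] [IsAlgClosed Ω]
    [Algebra L Ω]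
    {a b c u : L} (ha : a ≠ 0)
    (hdisc : b ^ 2 - 4 * a * c ≠ 0) (hu : u ≠ 0) {e : ℕ} (he : (e : L) ≠ 0) :
    ∃ ρ : Ω,
      aeval ρ ((C a * X ^ 2 + C b * X + C c : L[X]).comp (C u * X ^ e)) = 0 ∧
      aeval ρ (derivative ((C a * X ^ 2 + C b * X + C c : L[X]).comp (C u * X ^ e))) ≠ 0 := by
  have he0 : e ≠ 0 := by rintro rfl; simp at he
  set ι := algebraMap L Ω with hι
  have hd' : (ι b) ^ 2 - 4 * ι a * ι c ≠ 0 := by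
    have h := (map_ne_zero ι).2 hdisc
    rwa [map_sub, map_mul, map_mul, map_pow, map_ofNat] at h
  obtain ⟨r, hr0, hr⟩ := exists_ne_zero_root_quadratic (a := ι a) (by simpa using ha) hd'
  have hu' : ι u ≠ 0 := by simpa using hu
  have he' : (e : Ω) ≠ 0 := by
    rw [← map_natCast ι]
    exact (map_ne_zero ι).2 he
  obtain ⟨ρ, hρ⟩ := IsAlgClosed.exists_pow_nat_eq (r / ι u) (Nat.pos_of_ne_zero he0)
  have hρ0 : ρ ≠ 0 := by
    rintro rfl
    rw [zero_pow he0] at hρ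
    exact div_ne_zero hr0 hu' hρ.symm
  have hρr : ι u * ρ ^ e = r := by rw [hρ]; field_simp
  have hder : 2 * ι a * r + ι b ≠ 0 := by
    intro h
    apply hd'
    linear_combination (2 * ι a * r + ι b) * h - 4 * ι a * hr
  refine ⟨ρ, ?_, ?_⟩
  · simp [← hι, hρr, hr]
  · rw [derivative_comp]
    simp only [map_mul, aeval_comp]
    simp only [derivative_mul, derivative_C, derivative_X_pow, derivative_X,
      map_add, map_mul, aeval_C, aeval_X, map_pow, ← hι, hρr, zero_mul, zero_add, map_natCast,
      add_zero, mul_one]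
    refine mul_ne_zero (mul_ne_zero hu' (mul_ne_zero ?_ (pow_ne_zero _ hρ0))) ?_
    · simpa using he'
    · convert hder using 1
      simp
      ring

variable {F L : Type*} [Field F] [Fintype F] [Field L] [Fintype L] [Algebra F L]

lemma norm_sum_mulChar_norm_quadratic_le {n : ℕ} (hn : 0 < n)
    (hcard : Fintype.card L = (Fintype.card F ^ n) ^ 2) {ψ : MulChar F ℂ} (hψ : ψ ≠ 1)
    {a b c u : L} (ha : a ≠ 0) (hdisc : b ^ 2 - 4 * a * c ≠ 0) (hu : u ≠ 0)
    {e : ℕ} (he : (e : L) ≠ 0) :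
    ‖∑ t : L, ψ (Algebra.norm F (a * (u * t ^ e) ^ 2 + b * (u * t ^ e) + c))‖ ≤
      ((Fintype.card F - 1 : ℕ) * (4 * (2 * e : ℕ) + 8) + (2 * e : ℕ) : ℝ) *
        Fintype.card F ^ n := by
  obtain ⟨ρ, h1, h2⟩ := exists_simple_root_quadratic_comp (Ω := AlgebraicClosure L) ha hdisc hu he
  have := norm_sum_mulChar_norm_eval_le hn hcard hψ _ (m := 2 * e) (by
    refine natDegree_comp_le.trans (Nat.mul_le_mul natDegree_quadratic_le ?_)
    exact natDegree_C_mul_X_pow_le _ _) h1 h2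
  simpa [eval_comp] using this

theorem norm_sum_mulChar_norm_mul_quadratic_le {n : ℕ} (hn : 0 < n)
    (hcard : Fintype.card L = (Fintype.card F ^ n) ^ 2) (χ : MulChar F ℂ) {ψ : MulChar F ℂ}
    (hψ : ψ ≠ 1) {a b c : L} (ha : a ≠ 0) (hdisc : b ^ 2 - 4 * a * c ≠ 0) :
    ‖∑ x : L, χ (Algebra.norm F x) * ψ (Algebra.norm F (a * x ^ 2 + b * x + c))‖ ≤
      (10 * Fintype.card F ^ 2 + 1 : ℝ) * Fintype.card F ^ n := by
  classical
  obtain ⟨q, hq⟩ : ∃ q, q = Fintype.card F := ⟨_, rfl⟩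
  have hd := two_le_card_sub_one_of_mulChar_ne_one hψ
  have hdL : ((Fintype.card F - 1 : ℕ) : L) ≠ 0 := by
    rw [Nat.cast_sub (by omega), ← map_natCast (algebraMap F L) (Fintype.card F),
      FiniteField.cast_card_eq_zero]
    simp
  have hNpow : ∀ t : L, t ≠ 0 → Algebra.norm F t ^ (Fintype.card F - 1) = 1 := fun t ht =>
    FiniteField.pow_card_sub_one_eq_one _ (by simpa [Algebra.norm_eq_zero_iff] using ht)
  set d := Fintype.card F - 1 with hdd
  have hd0 : d ≠ 0 := by omega
  set G : L → ℂ := fun x => χ (Algebra.norm F x) * ψ (Algebra.norm F (a * x ^ 2 + b * x + c))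
    with hG
  set S := ∑ x : L, G x with hS
  have hG0 : G 0 = 0 := by simp [hG, MulChar.map_zero]
  set B : ℝ := ((d : ℕ) * (4 * (2 * d : ℕ) + 8) + (2 * d : ℕ) : ℝ) * Fintype.card F ^ n with hB
  have hinner : ∀ u : Lˣ, ‖∑ t : Lˣ, G (u * t ^ d)‖ ≤ B + 1 := by
    intro u
    have h1 := norm_sum_mulChar_norm_quadratic_le hn hcard hψ ha hdisc u.ne_zero hdL
    have h2 : ∑ t : Lˣ, G (u * t ^ d) = χ (Algebra.norm F (u : L)) *
        ((∑ t : L, ψ (Algebra.norm F (a * (u * t ^ d) ^ 2 + b * (u * t ^ d) + c))) -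
          ψ (Algebra.norm F c)) := by
      rw [← Finset.add_sum_erase _ _ (Finset.mem_univ (0 : L))]
      have h3 : a * (u * 0 ^ d) ^ 2 + b * (u * 0 ^ d) + c = c := by
        rw [zero_pow hd0]; ring
      rw [h3, add_sub_cancel_left, Finset.mul_sum]
      refine Finset.sum_bij (fun t _ => (t : L)) (by simp) (fun _ _ _ _ h => Units.ext h)
        (fun x hx => ⟨Units.mk0 x (Finset.ne_of_mem_erase hx), by simp⟩) ?_
      intro t _
      simp only [hG, map_mul, map_pow]
      rw [← map_pow χ, hNpow _ t.ne_zero, map_one, mul_one]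
    rw [h2, norm_mul]
    refine (mul_le_of_le_one_left (norm_nonneg _) (norm_mulChar_le_one _ _)).trans ?_
    refine (norm_sub_le _ _).trans (add_le_add h1 (norm_mulChar_le_one _ _))
  have hSu : S = ∑ u : Lˣ, G u := by
    rw [hS, ← Finset.add_sum_erase _ _ (Finset.mem_univ (0 : L)), hG0, zero_add]
    symm
    exact Finset.sum_bij (fun t _ => (t : L)) (by simp) (fun _ _ _ _ h => Units.ext h)
        (fun x hx => ⟨Units.mk0 x (Finset.ne_of_mem_erase hx), by simp⟩) (fun _ _ => rfl)
  have hdouble : (Fintype.card Lˣ : ℂ) * S = ∑ u : Lˣ, ∑ t : Lˣ, G (u * t ^ d) := by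
    rw [Finset.sum_comm]
    rw [Finset.sum_congr (g := fun _ => S) rfl, Finset.sum_const, nsmul_eq_mul, Finset.card_univ]
    intro t _
    rw [hSu]
    exact Fintype.sum_equiv (Equiv.mulRight (t ^ d)) _ _ (fun u => by simp)
  have hfin : (Fintype.card Lˣ : ℝ) * ‖S‖ ≤ Fintype.card Lˣ * (B + 1) := by
    calc (Fintype.card Lˣ : ℝ) * ‖S‖ = ‖(Fintype.card Lˣ : ℂ) * S‖ := by
          rw [norm_mul]; simp
      _ ≤ ∑ u : Lˣ, ‖∑ t : Lˣ, G (u * t ^ d)‖ := by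
          rw [hdouble]; exact norm_sum_le _ _
      _ ≤ ∑ u : Lˣ, (B + 1) := Finset.sum_le_sum fun u _ => hinner u
      _ = _ := by rw [Finset.sum_const, nsmul_eq_mul, Finset.card_univ]
  have hpos : (0 : ℝ) < Fintype.card Lˣ := by exact_mod_cast Fintype.card_pos
  refine (le_of_mul_le_mul_left hfin hpos).trans ?_
  have hM : (1 : ℝ) ≤ Fintype.card F ^ n := by
    exact_mod_cast Nat.one_le_pow _ _ Fintype.card_pos
  have hdq : (d : ℝ) + 1 = Fintype.card F := by exact_mod_cast (by omega : d + 1 = Fintype.card F)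
  rw [hB]
  push_cast
  have : (d : ℝ) * (4 * (2 * d) + 8) + 2 * d ≤ 10 * (Fintype.card F : ℝ) ^ 2 := by
    rw [← hdq]; nlinarith [(Nat.cast_nonneg d : (0 : ℝ) ≤ d)]
  nlinarith

theorem norm_sum_mulChar_norm_quadratic_le' {n : ℕ} (hn : 0 < n)
    (hcard : Fintype.card L = (Fintype.card F ^ n) ^ 2) {ψ : MulChar F ℂ}
    (hψ : ψ ≠ 1) {a b c : L} (ha : a ≠ 0) (hdisc : b ^ 2 - 4 * a * c ≠ 0) :
    ‖∑ x : L, ψ (Algebra.norm F (a * x ^ 2 + b * x + c))‖ ≤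
      (10 * Fintype.card F ^ 2 + 2 : ℝ) * Fintype.card F ^ n := by
  classical
  have h1 := norm_sum_mulChar_norm_mul_quadratic_le hn hcard 1 hψ ha hdisc
  have h2 : ∑ x : L, ψ (Algebra.norm F (a * x ^ 2 + b * x + c)) =
      (∑ x : L, (1 : MulChar F ℂ) (Algebra.norm F x) *
        ψ (Algebra.norm F (a * x ^ 2 + b * x + c))) + ψ (Algebra.norm F c) := by
    rw [← Finset.add_sum_erase _ _ (Finset.mem_univ (0 : L)),
      ← Finset.add_sum_erase (Finset.univ) (fun x : L => (1 : MulChar F ℂ) (Algebra.norm F x) *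
        ψ (Algebra.norm F (a * x ^ 2 + b * x + c))) (Finset.mem_univ (0 : L))]
    have h3 : ∀ x ∈ Finset.univ.erase (0 : L), (1 : MulChar F ℂ) (Algebra.norm F x) *
        ψ (Algebra.norm F (a * x ^ 2 + b * x + c)) =
        ψ (Algebra.norm F (a * x ^ 2 + b * x + c)) := by
      intro x hx
      rw [MulChar.one_apply, one_mul]
      rw [isUnit_iff_ne_zero, Ne, Algebra.norm_eq_zero_iff]
      exact Finset.ne_of_mem_erase hx
    rw [Finset.sum_congr rfl h3]
    simp [MulChar.map_zero]
  have hM : (1 : ℝ) ≤ Fintype.card F ^ n := by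
    exact_mod_cast Nat.one_le_pow _ _ Fintype.card_pos
  rw [h2]
  have := (norm_add_le (∑ x : L, (1 : MulChar F ℂ) (Algebra.norm F x) *
        ψ (Algebra.norm F (a * x ^ 2 + b * x + c))) (ψ (Algebra.norm F c))).trans
    (add_le_add h1 (norm_mulChar_le_one ψ _))
  nlinarith

end QuadraticExtensionSums

section MonicPolynomials

variable {F : Type*} [Field F] [Finite F]

lemma finite_monic_natDegree_eq (F : Type*) [Field F] [Finite F] (n : ℕ) :
    {f : F[X] | f.Monic ∧ f.natDegree = n}.Finite := by
  refine Set.Finite.of_injOn (f := fun f : F[X] => fun i : Fin (n + 1) => f.coeff i)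
    (t := Set.univ) (fun _ _ => Set.mem_univ _) ?_ Set.finite_univ
  intro f hf g hg h
  refine Polynomial.ext fun i => ?_
  by_cases hi : i < n + 1
  · exact congrFun h ⟨i, hi⟩
  · rw [coeff_eq_zero_of_natDegree_lt (by have := hf.2; omega),
      coeff_eq_zero_of_natDegree_lt (by have := hg.2; omega)]

/-- The monic polynomials of degree `n` over a finite field. -/
noncomputable def monicsOfDegree (F : Type*) [Field F] [Finite F] (n : ℕ) : Finset F[X] :=
  (finite_monic_natDegree_eq F n).toFinset

lemma mem_monicsOfDegree {n : ℕ} {f : F[X]} :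
    f ∈ monicsOfDegree F n ↔ f.Monic ∧ f.natDegree = n := by
  simp [monicsOfDegree]

open scoped Classical in
/-- The monic irreducible polynomials of degree at most `n` over a finite field. -/
noncomputable def monicIrreducibles (F : Type*) [Field F] [Finite F] (n : ℕ) : Finset F[X] :=
  ((Finset.range (n + 1)).biUnion (monicsOfDegree F)).filter Irreducible

lemma mem_monicIrreducibles {n : ℕ} {P : F[X]} :
    P ∈ monicIrreducibles F n ↔ P.Monic ∧ P.natDegree ≤ n ∧ Irreducible P := by
  simp only [monicIrreducibles, Finset.mem_filter, Finset.mem_biUnion, Finset.mem_range,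
    mem_monicsOfDegree]
  constructor
  · rintro ⟨⟨k, hk, h1, rfl⟩, h2⟩
    exact ⟨h1, by omega, h2⟩
  · rintro ⟨h1, h2, h3⟩
    exact ⟨⟨_, by omega, h1, rfl⟩, h3⟩

open scoped Classical in
lemma natDegree_eq_sum_monicIrreducibles {n : ℕ} {f : F[X]} (hf : f.Monic) (hn : f.natDegree = n) :
    n = ∑ P ∈ monicIrreducibles F n, ∑ k ∈ Finset.Icc 1 n,
      if P ^ k ∣ f then P.natDegree else 0 := by
  have hf0 := hf.ne_zero
  set s := UniqueFactorizationMonoid.normalizedFactors f with hs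
  have hprod : s.prod = f := by
    rw [hs, UniqueFactorizationMonoid.prod_normalizedFactors_eq hf0]
    exact hf.normalize_eq_self
  have hirr : ∀ P ∈ s, Irreducible P ∧ P.Monic := fun P hP => by
    have h1 := UniqueFactorizationMonoid.irreducible_of_normalized_factor P hP
    refine ⟨h1, ?_⟩
    rw [← UniqueFactorizationMonoid.normalize_normalized_factor P hP]
    exact monic_normalize h1.ne_zero
  have hdeg : n = ∑ P ∈ s.toFinset, s.count P * P.natDegree := by
    rw [← hn]
    conv_lhs => rw [← hprod]
    rw [natDegree_multiset_prod_of_monic _ fun P hP => (hirr P hP).2,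
      Finset.sum_multiset_map_count]
    simp
  have hmult : ∀ P : F[X], P.Monic → Irreducible P → ∀ k, P ^ k ∣ f ↔ k ≤ s.count P := by
    intro P hP hPi k
    rw [pow_dvd_iff_le_emultiplicity,
      UniqueFactorizationMonoid.emultiplicity_eq_count_normalizedFactors hPi hf0,
      hP.normalize_eq_self]
    exact Nat.cast_le
  have hcount : ∀ P : F[X], P.Monic → Irreducible P → s.count P ≤ n := by
    intro P hP hPi
    have h1 := (hmult P hP hPi _).2 le_rfl
    have h2 := natDegree_le_of_dvd h1 hf0
    rw [natDegree_pow, hn] at h2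
    exact (Nat.le_mul_of_pos_right _ hPi.natDegree_pos).trans h2
  have hinner : ∀ P : F[X], P.Monic → Irreducible P →
      (∑ k ∈ Finset.Icc 1 n, if P ^ k ∣ f then P.natDegree else 0) = s.count P * P.natDegree := by
    intro P hP hPi
    rw [← Finset.sum_filter, Finset.sum_const, smul_eq_mul]
    congr 1
    have : (Finset.Icc 1 n).filter (fun k => P ^ k ∣ f) = Finset.Icc 1 (s.count P) := by
      ext k
      have := hcount P hP hPi
      rw [Finset.mem_filter, hmult P hP hPi, Finset.mem_Icc, Finset.mem_Icc]
      omega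
    rw [this]; simp
  conv_lhs => rw [hdeg]
  rw [Finset.sum_congr rfl fun P hP => (hinner P (mem_monicIrreducibles.1 hP).1
    (mem_monicIrreducibles.1 hP).2.2)]
  refine Finset.sum_subset (fun P hP => ?_) (fun P _ hP => ?_)
  · have hP' := Multiset.mem_toFinset.1 hP
    refine mem_monicIrreducibles.2 ⟨(hirr P hP').2, ?_, (hirr P hP').1⟩
    rw [← hn]
    exact natDegree_le_of_dvd (UniqueFactorizationMonoid.dvd_of_mem_normalizedFactors hP') hf0
  · rw [Multiset.mem_toFinset] at hP
    simp [hP]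

variable (Ψ : F[X] → ℂ)

/-- The sum of `Ψ` over the monic polynomials of degree `n`. -/
noncomputable def monicSum (n : ℕ) : ℂ := ∑ f ∈ monicsOfDegree F n, Ψ f

open scoped Classical in
/-- The weighted sum over powers of monic irreducibles of total degree `j`
(the coefficients of the logarithmic derivative of the Euler product). -/
noncomputable def primePowerSum (j : ℕ) : ℂ :=
  ∑ P ∈ (monicIrreducibles F j).filter (fun P => P.natDegree ∣ j),
    P.natDegree * Ψ P ^ (j / P.natDegree)

lemma monicSum_zero (h1 : Ψ 1 = 1) : monicSum Ψ 0 = 1 := by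
  have : monicsOfDegree F 0 = {1} := by
    ext f
    rw [mem_monicsOfDegree, Finset.mem_singleton]
    constructor
    · rintro ⟨h, h'⟩; exact (h.natDegree_eq_zero).1 h'
    · rintro rfl; simp
  rw [monicSum, this, Finset.sum_singleton, h1]

variable {Ψ}

open scoped Classical in
lemma sum_filter_pow_dvd (h1 : Ψ 1 = 1)
    (hmul : ∀ f g : F[X], f.Monic → g.Monic → Ψ (f * g) = Ψ f * Ψ g) {P : F[X]} (hP : P.Monic)
    (k n : ℕ) :
    ∑ f ∈ (monicsOfDegree F n).filter (P ^ k ∣ ·), Ψ f =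
      if k * P.natDegree ≤ n then Ψ P ^ k * monicSum Ψ (n - k * P.natDegree) else 0 := by
  have hpow : Ψ (P ^ k) = Ψ P ^ k := by
    induction k with
    | zero => simp [h1]
    | succ k ih => rw [pow_succ, hmul _ _ (hP.pow k) hP, ih, pow_succ]
  have hPk := hP.pow k
  split_ifs with h
  · rw [monicSum, ← hpow, Finset.mul_sum]
    symm
    refine Finset.sum_bij (fun g _ => P ^ k * g) ?_ ?_ ?_ ?_
    · intro g hg
      rw [mem_monicsOfDegree] at hg
      rw [Finset.mem_filter, mem_monicsOfDegree]
      refine ⟨⟨hPk.mul hg.1, ?_⟩, dvd_mul_right _ _⟩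
      rw [hPk.natDegree_mul hg.1, hP.natDegree_pow, hg.2]
      omega
    · intro g _ g' _ hgg
      exact mul_left_cancel₀ hPk.ne_zero hgg
    · intro f hf
      rw [Finset.mem_filter, mem_monicsOfDegree] at hf
      obtain ⟨⟨hf1, hf2⟩, g, rfl⟩ := hf
      have hg := hPk.of_mul_monic_left hf1
      refine ⟨g, mem_monicsOfDegree.2 ⟨hg, ?_⟩, rfl⟩
      rw [hPk.natDegree_mul hg, hP.natDegree_pow] at hf2
      omega
    · intro g hg
      rw [hmul _ _ hPk (mem_monicsOfDegree.1 hg).1]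
  · rw [Finset.sum_eq_zero]
    intro f hf
    rw [Finset.mem_filter, mem_monicsOfDegree] at hf
    have := natDegree_le_of_dvd hf.2 hf.1.1.ne_zero
    rw [hP.natDegree_pow, hf.1.2] at this
    exact absurd this h

lemma primePowerSum_eq {j n : ℕ} (hj : j ∈ Finset.Icc 1 n) :
    primePowerSum Ψ j = ∑ P ∈ monicIrreducibles F n, ∑ k ∈ Finset.Icc 1 n,
      if k * P.natDegree = j then (P.natDegree : ℂ) * Ψ P ^ k else 0 := by
  classical
  rw [Finset.mem_Icc] at hj
  rw [primePowerSum, Finset.sum_filter]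
  have hzero : ∀ P ∈ monicIrreducibles F n, (if P.natDegree ∣ j then
      (P.natDegree : ℂ) * Ψ P ^ (j / P.natDegree) else 0) = ∑ k ∈ Finset.Icc 1 n,
      if k * P.natDegree = j then (P.natDegree : ℂ) * Ψ P ^ k else 0 := by
    intro P hP
    have hpos := (mem_monicIrreducibles.1 hP).2.2.natDegree_pos
    split_ifs with h
    · obtain ⟨k, rfl⟩ := h
      have hk : k ∈ Finset.Icc 1 n := by
        rw [Finset.mem_Icc]
        constructor
        · by_contra h0
          have : k = 0 := by omega
          subst this; omega
        · exact (Nat.le_mul_of_pos_left _ hpos).trans hj.2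
      rw [Finset.sum_eq_single_of_mem k hk, if_pos (mul_comm _ _), Nat.mul_div_cancel_left _ hpos]
      intro l _ hl
      rw [if_neg]
      intro h
      rw [mul_comm] at h
      exact hl (Nat.eq_of_mul_eq_mul_left hpos h)
    · rw [Finset.sum_eq_zero]
      intro k _
      rw [if_neg]
      rintro rfl
      exact h (dvd_mul_left _ _)
  rw [← Finset.sum_congr rfl hzero]
  refine Finset.sum_subset (fun P hP => ?_) (fun P hP hP' => ?_)
  · rw [mem_monicIrreducibles] at hP ⊢
    exact ⟨hP.1, hP.2.1.trans hj.2, hP.2.2⟩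
  · rw [mem_monicIrreducibles] at hP hP'
    rw [if_neg]
    intro h
    exact hP' ⟨hP.1, Nat.le_of_dvd (by omega) h, hP.2.2⟩

theorem natCast_mul_monicSum (h1 : Ψ 1 = 1)
    (hmul : ∀ f g : F[X], f.Monic → g.Monic → Ψ (f * g) = Ψ f * Ψ g) (n : ℕ) :
    n * monicSum Ψ n = ∑ j ∈ Finset.Icc 1 n, primePowerSum Ψ j * monicSum Ψ (n - j) := by
  classical
  calc (n : ℂ) * monicSum Ψ n
      = ∑ f ∈ monicsOfDegree F n, ∑ P ∈ monicIrreducibles F n, ∑ k ∈ Finset.Icc 1 n,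
        if P ^ k ∣ f then P.natDegree * Ψ f else 0 := by
        rw [monicSum, Finset.mul_sum]
        refine Finset.sum_congr rfl fun f hf => ?_
        rw [mem_monicsOfDegree] at hf
        conv_lhs => rw [natDegree_eq_sum_monicIrreducibles hf.1 hf.2]
        push_cast
        simp_rw [Finset.sum_mul, ite_mul, zero_mul]
    _ = ∑ P ∈ monicIrreducibles F n, ∑ k ∈ Finset.Icc 1 n,
        P.natDegree * ∑ f ∈ (monicsOfDegree F n).filter (P ^ k ∣ ·), Ψ f := by
        rw [Finset.sum_comm]
        refine Finset.sum_congr rfl fun P _ => ?_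
        rw [Finset.sum_comm]
        refine Finset.sum_congr rfl fun k _ => ?_
        rw [Finset.mul_sum, Finset.sum_filter]
    _ = ∑ P ∈ monicIrreducibles F n, ∑ k ∈ Finset.Icc 1 n, ∑ j ∈ Finset.Icc 1 n,
        if k * P.natDegree = j then (P.natDegree * Ψ P ^ k) * monicSum Ψ (n - j) else 0 := by
        refine Finset.sum_congr rfl fun P hP => Finset.sum_congr rfl fun k hk => ?_
        rw [mem_monicIrreducibles] at hP
        rw [sum_filter_pow_dvd h1 hmul hP.1, Finset.sum_ite_eq, mul_ite, mul_zero, mul_assoc]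
        refine if_congr ?_ rfl rfl
        have := Nat.mul_pos (Finset.mem_Icc.1 hk).1 hP.2.2.natDegree_pos
        rw [Finset.mem_Icc]
        omega
    _ = _ := by
        have : ∀ j ∈ Finset.Icc 1 n, primePowerSum Ψ j * monicSum Ψ (n - j) =
            ∑ P ∈ monicIrreducibles F n, ∑ k ∈ Finset.Icc 1 n, if k * P.natDegree = j then
              (P.natDegree * Ψ P ^ k) * monicSum Ψ (n - j) else 0 := by
          intro j hj
          rw [primePowerSum_eq hj, Finset.sum_mul]
          simp_rw [Finset.sum_mul, ite_mul, zero_mul]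
        rw [Finset.sum_congr rfl this]
        rw [Finset.sum_comm]
        conv_rhs => rw [Finset.sum_comm]
        rw [Finset.sum_comm]
        refine Finset.sum_congr rfl fun P _ => ?_
        rw [Finset.sum_comm]

end MonicPolynomials

section PowerSums

lemma norm_sq_le_of_norm_pow_add_pow_le {α β : ℂ} {C q : ℝ} (hq : 1 ≤ q)
    (h : ∀ n : ℕ, 0 < n → ‖α ^ (2 * n) + β ^ (2 * n)‖ ≤ C * q ^ n) : ‖α‖ ^ 2 ≤ q := by
  have hq0 : 0 < q := by linarith
  have hC : 0 ≤ C := by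
    have := (norm_nonneg _).trans (h 1 one_pos)
    rw [pow_one] at this
    exact nonneg_of_mul_nonneg_left this hq0
  set C' := C ^ 2 + C with hC'
  have hbound : ∀ n : ℕ, 0 < n → (‖α‖ ^ 2) ^ n ≤ (C + C' + 1) * q ^ n := by
    intro n hn
    have hp := h n hn
    have hp2 := h (2 * n) (by omega)
    set x := α ^ (2 * n) with hx
    set y := β ^ (2 * n) with hy
    set Q := q ^ n with hQ
    have hQ0 : 0 < Q := pow_pos hq0 n
    have hx2 : α ^ (2 * (2 * n)) = x ^ 2 := by rw [hx, ← pow_mul]; ring_nf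
    have hy2 : β ^ (2 * (2 * n)) = y ^ 2 := by rw [hy, ← pow_mul]; ring_nf
    have hQ2 : q ^ (2 * n) = Q ^ 2 := by rw [hQ, ← pow_mul]; ring_nf
    rw [hx2, hy2, hQ2] at hp2
    have hxy : ‖x * y‖ ≤ C' * Q ^ 2 := by
      have e : 2 * (x * y) = (x + y) ^ 2 - (x ^ 2 + y ^ 2) := by ring
      have h1 : ‖2 * (x * y)‖ ≤ ‖x + y‖ ^ 2 + ‖x ^ 2 + y ^ 2‖ := by
        rw [e, ← norm_pow]
        exact norm_sub_le _ _
      rw [norm_mul, Complex.norm_ofNat] at h1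
      have h2 : ‖x + y‖ ^ 2 ≤ (C * Q) ^ 2 := pow_le_pow_left₀ (norm_nonneg _) hp 2
      nlinarith [norm_nonneg (x * y)]
    have hquad : ‖x‖ ^ 2 ≤ C * Q * ‖x‖ + C' * Q ^ 2 := by
      have e : x ^ 2 = (x + y) * x - x * y := by ring
      rw [← norm_pow, e]
      refine (norm_sub_le _ _).trans (add_le_add ?_ hxy)
      rw [norm_mul]
      exact mul_le_mul_of_nonneg_right hp (norm_nonneg _)
    have hxα : (‖α‖ ^ 2) ^ n = ‖x‖ := by rw [hx, norm_pow, pow_mul]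
    rw [hxα]
    by_contra hlt
    push Not at hlt
    have hC'0 : 0 ≤ C' := by positivity
    have hQx : Q ≤ ‖x‖ := by nlinarith
    have h3 : C' * Q ^ 2 ≤ C' * (Q * ‖x‖) := by gcongr; nlinarith
    nlinarith
  by_contra hlt
  push Not at hlt
  have hr : 1 < ‖α‖ ^ 2 / q := (one_lt_div hq0).2 hlt
  obtain ⟨n, hn⟩ := pow_unbounded_of_one_lt (C + C' + 1) hr
  have hn1 : (‖α‖ ^ 2 / q) ^ n ≤ (‖α‖ ^ 2 / q) ^ (n + 1) := pow_le_pow_right₀ hr.le (by omega)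
  have h4 := hbound (n + 1) (by omega)
  rw [div_pow, div_pow] at hn1
  rw [div_pow] at hn
  have h5 : (‖α‖ ^ 2) ^ (n + 1) / q ^ (n + 1) ≤ C + C' + 1 :=
    (div_le_iff₀ (pow_pos hq0 _)).2 h4
  linarith

lemma exists_add_eq_mul_eq (s t : ℂ) : ∃ α β : ℂ, α + β = s ∧ α * β = t := by
  obtain ⟨α, hα⟩ := IsAlgClosed.exists_root (C 1 * X ^ 2 + C (-s) * X + C t : ℂ[X])
    (by rw [degree_quadratic one_ne_zero]; decide)
  have : 1 * α ^ 2 + (-s) * α + t = 0 := by simpa [IsRoot] using hα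
  exact ⟨α, s - α, by ring, by linear_combination -this⟩

lemma eq_neg_pow_add_pow {s c : ℕ → ℂ} (hs0 : s 0 = 1)
    (hnewton : ∀ n : ℕ, n * s n = ∑ j ∈ Finset.Icc 1 n, c j * s (n - j))
    (hs : ∀ n, 3 ≤ n → s n = 0) {α β : ℂ} (h1 : α + β = -s 1) (h2 : α * β = s 2) {n : ℕ}
    (hn : 0 < n) :
    c n = -(α ^ n + β ^ n) := by
  have e1 := hnewton 1
  have e2 := hnewton 2
  simp [Finset.sum_Icc_succ_top, hs0] at e1 e2
  induction n using Nat.strong_induction_on with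
  | _ n ih =>
    rcases (by omega : n = 1 ∨ n = 2 ∨ 3 ≤ n) with rfl | rfl | h3
    · linear_combination -e1 + h1
    · linear_combination -e2 + e1 * s 1 - 2 * h2 - (s 1 - α - β) * h1
    · obtain ⟨k, rfl⟩ := Nat.exists_eq_add_of_le' h3
      have e := hnewton (k + 3)
      rw [hs _ h3, mul_zero, Finset.sum_Icc_succ_top (by omega),
        Finset.sum_Icc_succ_top (by omega), Finset.sum_Icc_succ_top (by omega),
        Finset.sum_eq_zero] at e
      · have i1 := ih (k + 1) (by omega) (by omega)
        have i2 := ih (k + 2) (by omega) (by omega)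
        have a1 : k + 3 - (k + 1) = 2 := by omega
        have a2 : k + 3 - (k + 1 + 1) = 1 := by omega
        have a3 : k + 3 - (k + 2 + 1) = 0 := by omega
        rw [a1, a2, a3, hs0, i1, show k + 1 + 1 = k + 2 from rfl, i2] at e
        rw [show k + 3 = k + 2 + 1 from rfl]
        linear_combination -e - (α ^ (k + 1) + β ^ (k + 1)) * h2
          + (α ^ (k + 2) + β ^ (k + 2)) * h1
      · intro j hj
        rw [Finset.mem_Icc] at hj
        rw [hs _ (by omega), mul_zero]

theorem norm_le_two_mul_sqrt {s c : ℕ → ℂ} (hs0 : s 0 = 1)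
    (hnewton : ∀ n : ℕ, n * s n = ∑ j ∈ Finset.Icc 1 n, c j * s (n - j))
    (hs : ∀ n, 3 ≤ n → s n = 0) {C q : ℝ} (hq : 1 ≤ q)
    (hc : ∀ n : ℕ, 0 < n → ‖c (2 * n)‖ ≤ C * q ^ n) : ‖c 1‖ ≤ 2 * √q := by
  obtain ⟨α, β, h1, h2⟩ := exists_add_eq_mul_eq (-s 1) (s 2)
  have h := fun n hn => eq_neg_pow_add_pow hs0 hnewton hs h1 h2 (n := n) hn
  have hb : ∀ n : ℕ, 0 < n → ‖α ^ (2 * n) + β ^ (2 * n)‖ ≤ C * q ^ n := by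
    intro n hn
    rw [← norm_neg, ← h _ (by omega)]
    exact hc n hn
  have hα := Real.le_sqrt_of_sq_le (norm_sq_le_of_norm_pow_add_pow_le hq hb)
  have hβ := Real.le_sqrt_of_sq_le (norm_sq_le_of_norm_pow_add_pow_le hq (α := β) (β := α)
    fun n hn => by rw [add_comm]; exact hb n hn)
  rw [h 1 one_pos, norm_neg, pow_one, pow_one]
  linarith [norm_add_le α β]

theorem norm_le_sqrt {s c : ℕ → ℂ} (hs0 : s 0 = 1)
    (hnewton : ∀ n : ℕ, n * s n = ∑ j ∈ Finset.Icc 1 n, c j * s (n - j))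
    (hs : ∀ n, 3 ≤ n → s n = 0) {C q : ℝ} (hq : 1 ≤ q) (hs2 : s 2 = 0)
    (hc : ∀ n : ℕ, 0 < n → ‖c (2 * n)‖ ≤ C * q ^ n) : ‖c 1‖ ≤ √q := by
  have h := fun n hn => eq_neg_pow_add_pow hs0 hnewton hs (α := -s 1) (β := 0) (by simp)
    (by simp [hs2]) (n := n) hn
  have hb : ∀ n : ℕ, 0 < n → ‖(-s 1) ^ (2 * n) + 0 ^ (2 * n)‖ ≤ C * q ^ n := by
    intro n hn
    rw [← norm_neg, ← h _ (by omega)]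
    exact hc n hn
  have hα := Real.le_sqrt_of_sq_le (norm_sq_le_of_norm_pow_add_pow_le hq hb)
  rw [h 1 one_pos, norm_neg, pow_one, pow_one, add_zero]
  exact hα

end PowerSums

section PrimePowerSumExtension

variable {F L : Type*} [Field F] [Fintype F] [Field L] [Fintype L] [Algebra F L]

lemma splits_map_of_natDegree_dvd_finrank {P : F[X]} (hP : Irreducible P)
    (h : P.natDegree ∣ Module.finrank F L) : (P.map (algebraMap F L)).Splits := by
  have h1 := hP.natDegree_dvd_iff_dvd_X_pow_card_pow_sub_X.1 h
  have hcard : Nat.card F ^ Module.finrank F L = Fintype.card L := by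
    rw [Nat.card_eq_fintype_card, ← Module.card_eq_pow_finrank]
  rw [hcard] at h1
  have h2 := Polynomial.map_dvd (algebraMap F L) h1
  rw [Polynomial.map_sub, Polynomial.map_pow, map_X] at h2
  refine Splits.of_dvd ?_ (FiniteField.X_pow_card_sub_X_ne_zero L Fintype.one_lt_card) h2
  rw [splits_iff_card_roots, FiniteField.roots_X_pow_card_sub_X,
    FiniteField.X_pow_card_sub_X_natDegree_eq _ Fintype.one_lt_card, ← Finset.card_def,
    Finset.card_univ]

open scoped Classical in
lemma card_filter_minpoly_eq {P : F[X]} (hP : Irreducible P) (hPm : P.Monic)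
    (h : P.natDegree ∣ Module.finrank F L) :
    (Finset.univ.filter fun x : L => minpoly F x = P).card = P.natDegree := by
  rw [← card_rootSet_eq_natDegree (K := L) (PerfectField.separable_of_irreducible hP)
    (splits_map_of_natDegree_dvd_finrank hP h), ← Set.toFinset_card]
  congr 1
  ext x
  rw [Finset.mem_filter, Set.mem_toFinset, mem_rootSet]
  constructor
  · rintro ⟨-, rfl⟩
    exact ⟨hP.ne_zero, minpoly.aeval _ _⟩
  · rintro ⟨-, hx⟩
    exact ⟨Finset.mem_univ _, (minpoly.eq_of_irreducible_of_monic hP hx hPm).symm⟩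

theorem primePowerSum_finrank (Ψ : F[X] → ℂ) :
    primePowerSum Ψ (Module.finrank F L) =
      ∑ x : L, Ψ (minpoly F x) ^ (Module.finrank F L / (minpoly F x).natDegree) := by
  classical
  have hmaps : ∀ x ∈ (Finset.univ : Finset L), minpoly F x ∈
      (monicIrreducibles F (Module.finrank F L)).filter
        (fun P => P.natDegree ∣ Module.finrank F L) := by
    intro x _
    have hx : IsIntegral F x := Algebra.IsIntegral.isIntegral x
    have hd : (minpoly F x).natDegree ∣ Module.finrank F L := minpoly.degree_dvd hx
    rw [Finset.mem_filter, mem_monicIrreducibles]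
    exact ⟨⟨minpoly.monic hx, Nat.le_of_dvd Module.finrank_pos hd, minpoly.irreducible hx⟩, hd⟩
  rw [primePowerSum, ← Finset.sum_fiberwise_of_maps_to hmaps]
  refine Finset.sum_congr rfl fun P hP => ?_
  rw [Finset.mem_filter, mem_monicIrreducibles] at hP
  rw [Finset.sum_congr (g := fun _ => Ψ P ^ (Module.finrank F L / P.natDegree)) rfl,
    Finset.sum_const, nsmul_eq_mul, card_filter_minpoly_eq hP.1.2.2 hP.1.1 hP.2]
  intro x hx
  rw [(Finset.mem_filter.1 hx).2]

open IntermediateField in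
lemma norm_aeval_eq_resultant_pow (x : L) (h : F[X]) {m : ℕ} (hm : h.natDegree ≤ m) :
    Algebra.norm F (aeval x h) = resultant (minpoly F x) h (minpoly F x).natDegree m ^
      (Module.finrank F L / (minpoly F x).natDegree) := by
  classical
  have hx : IsIntegral F x := Algebra.IsIntegral.isIntegral x
  set P := minpoly F x with hP
  have hPm : P.Monic := minpoly.monic hx
  have hdeg : Module.finrank F F⟮x⟯ = P.natDegree := adjoin.finrank hx
  have hfin : Module.finrank F L / P.natDegree = Module.finrank F⟮x⟯ L := by
    rw [← Module.finrank_mul_finrank F F⟮x⟯ L, hdeg]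
    exact Nat.mul_div_cancel_left _ (minpoly.natDegree_pos hx)
  have hgen : aeval x h = algebraMap F⟮x⟯ L (aeval (AdjoinSimple.gen F x) h) := by
    rw [← aeval_algebraMap_apply, AdjoinSimple.algebraMap_gen]
  rw [hgen, ← Algebra.norm_norm (S := F⟮x⟯), Algebra.norm_algebraMap, map_pow, hfin]
  congr 1
  let Ω := AlgebraicClosure F
  apply (algebraMap F Ω).injective
  let pb := adjoin.powerBasis hx
  have hpb : pb.gen = AdjoinSimple.gen F x := adjoin.powerBasis_gen hx
  have hmin : minpoly F pb.gen = P := by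
    rw [hpb, hP, ← minpoly.algebraMap_eq (algebraMap F⟮x⟯ L).injective, AdjoinSimple.algebraMap_gen]
  have hsep : P.Separable := PerfectField.separable_of_irreducible (minpoly.irreducible hx)
  rw [← resultant_map_map, ← natDegree_map (algebraMap F Ω) (p := P),
    resultant_eq_prod_eval _ _ _ (natDegree_map_le.trans hm) (IsAlgClosed.splits _),
    (hPm.map _).leadingCoeff, one_pow, one_mul, Algebra.norm_eq_prod_embeddings F Ω]
  rw [Fintype.prod_equiv pb.liftEquiv' _ (fun y => (h.map (algebraMap F Ω)).eval (y : Ω))]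
  · rw [hmin, Finset.prod_mem_multiset _ _ (fun y => (h.map (algebraMap F Ω)).eval y) fun _ => rfl,
      Finset.prod_eq_multiset_prod, Multiset.toFinset_val,
      Multiset.dedup_eq_self.mpr (nodup_roots hsep.map)]
  · intro σ
    rw [PowerBasis.liftEquiv'_apply_coe, eval_map_algebraMap, aeval_algHom_apply, hpb]

end PrimePowerSumExtension

section QuadraticForm

variable {F : Type*} [Field F] [Fintype F]

lemma exists_ne_zero_mulChar_ne_one {F : Type*} [Field F] {ψ : MulChar F ℂ} (hψ : ψ ≠ 1) :
    ∃ ν : F, ν ≠ 0 ∧ ψ ν ≠ 1 := by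
  obtain ⟨u, hu⟩ := (MulChar.ne_one_iff).1 hψ
  exact ⟨u, u.ne_zero, hu⟩

lemma sum_mulChar_sq_sub_mul_sq {ψ : MulChar F ℂ} (hψ : ψ ≠ 1) (hF : Odd (Fintype.card F))
    {D : F} (hD : D ≠ 0) : ∑ z : F × F, ψ (z.1 ^ 2 - D * z.2 ^ 2) = 0 := by
  obtain ⟨ν, hν0, hν⟩ := exists_ne_zero_mulChar_ne_one hψ
  obtain ⟨r, s, hrs⟩ := FiniteField.exists_root_sum_quadratic (R := F)
    (f := C 1 * X ^ 2 + C 0 * X + C (-ν)) (g := C (-D) * X ^ 2 + C 0 * X + C 0)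
    (degree_quadratic one_ne_zero) (degree_quadratic (neg_ne_zero.2 hD)) (Nat.odd_iff.1 hF)
  have hνrs : ν = r ^ 2 - D * s ^ 2 := by
    simp at hrs
    linear_combination -hrs
  let φ : F × F → F × F := fun z => (z.1 * r + D * z.2 * s, z.1 * s + z.2 * r)
  have hφ : Function.Bijective φ := by
    rw [← Finite.injective_iff_bijective]
    rintro ⟨x, y⟩ ⟨x', y'⟩ h
    simp only [φ, Prod.mk.injEq] at h
    refine Prod.ext (mul_left_cancel₀ hν0 ?_) (mul_left_cancel₀ hν0 ?_)
    · simp only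
      rw [hνrs]; linear_combination r * h.1 - D * s * h.2
    · simp only
      rw [hνrs]; linear_combination r * h.2 - s * h.1
  have h1 : ∑ z : F × F, ψ (z.1 ^ 2 - D * z.2 ^ 2) =
      ψ ν * ∑ z : F × F, ψ (z.1 ^ 2 - D * z.2 ^ 2) := by
    conv_lhs => rw [← hφ.sum_comp]
    rw [Finset.mul_sum]
    refine Finset.sum_congr rfl fun z _ => ?_
    rw [← map_mul, hνrs]
    congr 1
    simp only [φ]
    ring
  have h2 : (1 - ψ ν) * ∑ z : F × F, ψ (z.1 ^ 2 - D * z.2 ^ 2) = 0 := by linear_combination h1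
  exact (mul_eq_zero.1 h2).resolve_left (sub_ne_zero.2 hν.symm)

theorem sum_mulChar_quadraticForm {ψ : MulChar F ℂ} (hψ : ψ ≠ 1) {a b c : F} (ha : a ≠ 0)
    (hdisc : b ^ 2 - 4 * a * c ≠ 0) :
    ∑ u : F, ∑ v : F, ψ (a * v ^ 2 - b * u * v + c * u ^ 2) = 0 := by
  rw [Finset.sum_comm]
  by_cases h2 : ringChar F = 2
  · obtain ⟨ν, hν0, hν⟩ := exists_ne_zero_mulChar_ne_one hψ
    obtain ⟨l, hl⟩ := FiniteField.isSquare_of_char_two h2 ν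
    have hl0 : l ≠ 0 := by rintro rfl; simp at hl; exact hν0 hl
    have h1 : ∑ v : F, ∑ u : F, ψ (a * v ^ 2 - b * u * v + c * u ^ 2) =
        ψ ν * ∑ v : F, ∑ u : F, ψ (a * v ^ 2 - b * u * v + c * u ^ 2) := by
      rw [Finset.mul_sum]
      refine (Fintype.sum_equiv (Equiv.mulLeft₀ l hl0) _ _ fun v => ?_).symm
      rw [Finset.mul_sum]
      refine Fintype.sum_equiv (Equiv.mulLeft₀ l hl0) _ _ fun u => ?_
      rw [← map_mul, hl]
      congr 1
      simp only [Equiv.mulLeft₀_apply]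
      ring
    have h2 : (1 - ψ ν) * ∑ v : F, ∑ u : F, ψ (a * v ^ 2 - b * u * v + c * u ^ 2) = 0 := by
      linear_combination h1
    exact (mul_eq_zero.1 h2).resolve_left (sub_ne_zero.2 hν.symm)
  · have hodd := FiniteField.odd_card_of_char_ne_two h2
    have h2' : (2 : F) ≠ 0 := Ring.two_ne_zero h2
    have h4a : 4 * a ≠ 0 := by
      rw [show (4 : F) = 2 * 2 by norm_num]
      exact mul_ne_zero (mul_ne_zero h2' h2') ha
    have hψ4 : ψ (4 * a) ≠ 0 := ((isUnit_iff_ne_zero.2 h4a).map ψ).ne_zero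
    have key := sum_mulChar_sq_sub_mul_sq hψ (Nat.odd_iff.2 hodd) hdisc
    refine (mul_eq_zero.1 ?_).resolve_left hψ4
    rw [← key, Fintype.sum_prod_type_right, Finset.sum_comm, Finset.mul_sum]
    refine Finset.sum_congr rfl fun u _ => ?_
    rw [Finset.mul_sum]
    refine Fintype.sum_equiv ((Equiv.mulLeft₀ (2 * a) (mul_ne_zero h2' ha)).trans
      (Equiv.subRight (b * u))) _ _ fun v => ?_
    rw [← map_mul, Equiv.trans_apply, Equiv.mulLeft₀_apply, Equiv.subRight_apply]
    congr 1
    ring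

end QuadraticForm

section Vanishing

variable {F : Type*} [Field F] [Fintype F]

lemma sum_monicsOfDegree_add_two {g : F[X]} (hg : g.Monic) (hg2 : g.natDegree = 2) (k : ℕ)
    (G : F[X] → ℂ) : ∑ f ∈ monicsOfDegree F (k + 2), G f =
      ∑ p ∈ monicsOfDegree F k, ∑ u : F, ∑ v : F, G (C u * X + C v + g * p) := by
  simp_rw [← Fintype.sum_prod_type', ← Finset.sum_product']
  symm
  have hlin : ∀ u v : F, (C u * X + C v).degree < g.degree := fun u v => by
    rw [degree_eq_natDegree hg.ne_zero, hg2]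
    exact degree_linear_le.trans_lt (by decide)
  refine Finset.sum_bij (fun z _ => C z.2.1 * X + C z.2.2 + g * z.1) ?_ ?_ ?_ fun _ _ => rfl
  · rintro ⟨p, u, v⟩ hz
    have hp := mem_monicsOfDegree.1 (Finset.mem_product.1 hz).1
    have hgp := hg.mul hp.1
    have hlt : (C u * X + C v).degree < (g * p).degree := by
      refine (hlin u v).trans_le ?_
      rw [degree_mul]
      exact le_add_of_nonneg_right (zero_le_degree_iff.2 hp.1.ne_zero)
    refine mem_monicsOfDegree.2 ⟨hgp.add_of_right hlt, ?_⟩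
    rw [natDegree_add_eq_right_of_degree_lt hlt, hg.natDegree_mul hp.1, hg2, hp.2, add_comm]
  · rintro ⟨p, u, v⟩ _ ⟨p', u', v'⟩ _ h
    obtain ⟨h1, h2⟩ := div_modByMonic_unique p (C u * X + C v) hg ⟨rfl, hlin u v⟩
    obtain ⟨h1', h2'⟩ := div_modByMonic_unique p' (C u' * X + C v') hg ⟨rfl, hlin u' v'⟩
    simp only at h
    have e1 : p = p' := by rw [← h1, ← h1', h]
    have e2 : C u * X + C v = C u' * X + C v' := by rw [← h2, ← h2', h]
    have e3 := congrArg (coeff · 1) e2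
    have e4 := congrArg (coeff · 0) e2
    simp at e3 e4
    rw [e1, e3, e4]
  · intro f hf
    rw [mem_monicsOfDegree] at hf
    have hdeg : (f %ₘ g).degree ≤ 1 := by
      have := degree_modByMonic_lt f hg
      rw [degree_eq_natDegree hg.ne_zero, hg2] at this
      exact Order.le_of_lt_succ this
    have hle : g.degree ≤ f.degree := by
      rw [degree_eq_natDegree hg.ne_zero, degree_eq_natDegree hf.1.ne_zero, hg2, hf.2]
      exact_mod_cast Nat.le_add_left 2 k
    refine ⟨(f /ₘ g, (f %ₘ g).coeff 1, (f %ₘ g).coeff 0), ?_, ?_⟩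
    · rw [Finset.mem_product]
      refine ⟨mem_monicsOfDegree.2 ⟨?_, ?_⟩, Finset.mem_univ _⟩
      · rw [Monic, leadingCoeff_divByMonic_of_monic hg hle, hf.1]
      · rw [natDegree_divByMonic _ hg, hg2, hf.2]; omega
    · simp only
      rw [← eq_X_add_C_of_degree_le_one hdeg, modByMonic_add_div]

lemma sum_eval_zero_monicsOfDegree {k : ℕ} (hk : 0 < k) {χ : MulChar F ℂ} (hχ : χ ≠ 1)
    {r : F} (hr : r ≠ 0) (s : F) :
    ∑ p ∈ monicsOfDegree F k, χ (r * p.eval 0 + s) = 0 := by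
  have hshift : ∀ t : F, ∑ p ∈ monicsOfDegree F k, χ (r * p.eval 0 + s) =
      ∑ p ∈ monicsOfDegree F k, χ (r * (p.eval 0 + t) + s) := by
    have hlt : ∀ (t : F) (p : F[X]), p ∈ monicsOfDegree F k → (C t).degree < p.degree := by
      intro t p hp
      rw [mem_monicsOfDegree] at hp
      refine degree_C_le.trans_lt ?_
      rw [degree_eq_natDegree hp.1.ne_zero, hp.2]
      exact_mod_cast hk
    have hmem : ∀ (t : F) (p : F[X]), p ∈ monicsOfDegree F k → p + C t ∈ monicsOfDegree F k := by
      intro t p hp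
      have := hlt t p hp
      rw [mem_monicsOfDegree] at hp ⊢
      exact ⟨hp.1.add_of_left this, by rw [natDegree_add_eq_left_of_degree_lt this, hp.2]⟩
    intro t
    refine Finset.sum_bij' (fun p _ => p + C (-t)) (fun p _ => p + C t)
      (fun p hp => hmem _ p hp) (fun p hp => hmem _ p hp) (fun p _ => ?_) (fun p _ => ?_)
      fun p _ => ?_
    · simp
    · simp
    · simp
  have h1 : (Fintype.card F : ℂ) * ∑ p ∈ monicsOfDegree F k, χ (r * p.eval 0 + s) = 0 := by
    rw [← Finset.card_univ, ← nsmul_eq_mul, ← Finset.sum_const,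
      Finset.sum_congr rfl fun t _ => hshift t, Finset.sum_comm]
    refine Finset.sum_eq_zero fun p _ => ?_
    rw [← MulChar.sum_eq_zero_of_ne_one hχ]
    exact Fintype.sum_equiv (((Equiv.addLeft (p.eval 0)).trans
      (Equiv.mulLeft₀ r hr)).trans (Equiv.addRight s)) _ _ fun _ => rfl
  exact (mul_eq_zero.1 h1).resolve_left (by simp)

lemma resultant_linear_quadratic {F : Type*} [Field F] (a b c u v : F) :
    resultant (C u * X + C v) (C a * X ^ 2 + C b * X + C c) 1 2 =
      a * v ^ 2 - b * u * v + c * u ^ 2 := by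
  by_cases hu : u = 0
  · subst hu
    have h : (C a * X ^ 2 + C b * X + C c : F[X]).coeff 2 = a := by simp
    rw [map_zero, zero_mul, zero_add, ← mul_one (C v), resultant_C_mul_left, resultant_one_left, h]
    ring
  · have : C u * X + C v = C u * (X + C (v / u)) := by
      rw [mul_add, ← C_mul, mul_div_cancel₀ _ hu]
    rw [this, resultant_C_mul_left, resultant_X_add_C_left _ _ _ natDegree_quadratic_le]
    simp
    field_simp
    ring

lemma resultant_linear_add_mul_quadratic {F : Type*} [Field F] {a : F} (b c u v : F) {k : ℕ}
    {p : F[X]}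
    (hp : p.natDegree ≤ k) :
    resultant (C u * X + C v + (C a * X ^ 2 + C b * X + C c) * p)
      (C a * X ^ 2 + C b * X + C c) (k + 2) 2 =
      a ^ (k + 1) * (a * v ^ 2 - b * u * v + c * u ^ 2) := by
  have h : (C a * X ^ 2 + C b * X + C c : F[X]).coeff 2 = a := by simp
  rw [resultant_add_mul_left _ _ _ _ _ (by omega) natDegree_quadratic_le,
    show k + 2 = 1 + (k + 1) by ring, resultant_add_left_deg _ _ _ _ _ natDegree_linear_le, h,
    resultant_linear_quadratic, pow_mul]
  simp

end Vanishing

section CharacterSums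

variable {F : Type*} [Field F]

/-- The multiplicative weight on monic polynomials attached to a character and a polynomial `h` of
degree at most `m`. -/
noncomputable def resultantWeight (ψ : MulChar F ℂ) (h : F[X]) (m : ℕ) (f : F[X]) : ℂ :=
  ψ (resultant f h f.natDegree m)

variable (ψ χ : MulChar F ℂ) {h : F[X]} {m : ℕ}

lemma resultantWeight_one : resultantWeight ψ h m 1 = 1 := by
  simp [resultantWeight]

lemma resultantWeight_mul (hm : h.natDegree ≤ m) {f g : F[X]} (hf : f.Monic) (hg : g.Monic) :
    resultantWeight ψ h m (f * g) = resultantWeight ψ h m f * resultantWeight ψ h m g := by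
  rw [resultantWeight, hf.natDegree_mul hg, resultant_mul_left _ _ _ _ hm, map_mul]
  rfl

variable [Fintype F]

lemma resultantWeight_minpoly_pow (hm : h.natDegree ≤ m) {L : Type*} [Field L] [Fintype L]
    [Algebra F L] (x : L) :
    resultantWeight ψ h m (minpoly F x) ^ (Module.finrank F L / (minpoly F x).natDegree) =
      ψ (Algebra.norm F (aeval x h)) := by
  rw [resultantWeight, ← map_pow, ← norm_aeval_eq_resultant_pow x h hm]

variable {ψ χ} {a b c : F}

lemma resultantWeight_linear_add_mul_quadratic (ha : a ≠ 0) (u v : F) {k : ℕ} {p : F[X]}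
    (hp : p ∈ monicsOfDegree F k) :
    resultantWeight ψ (C a * X ^ 2 + C b * X + C c) 2
      (C u * X + C v + (C a * X ^ 2 + C b * X + C c) * C a⁻¹ * p) =
      ψ (a ^ (k + 1)) * ψ (a * v ^ 2 - b * u * v + c * u ^ 2) := by
  obtain ⟨hpm, hpk⟩ := mem_monicsOfDegree.1 hp
  have hQ0 : (C a * X ^ 2 + C b * X + C c : F[X]) ≠ 0 := by
    intro h0
    have := natDegree_quadratic (b := b) (c := c) ha
    rw [h0] at this
    simp at this
  have hQp : ((C a * X ^ 2 + C b * X + C c) * (C a⁻¹ * p)).natDegree = k + 2 := by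
    rw [natDegree_mul hQ0 (mul_ne_zero (by simpa using ha) hpm.ne_zero),
      natDegree_C_mul (inv_ne_zero ha), natDegree_quadratic ha, hpk, add_comm]
  have hdeg : (C u * X + C v + (C a * X ^ 2 + C b * X + C c) * (C a⁻¹ * p)).natDegree = k + 2 := by
    rw [natDegree_add_eq_right_of_natDegree_lt, hQp]
    rw [hQp]
    exact natDegree_linear_le.trans_lt (by omega)
  rw [resultantWeight, mul_assoc, hdeg, resultant_linear_add_mul_quadratic, map_mul]
  rw [natDegree_C_mul (inv_ne_zero ha), hpk]

lemma monic_quadratic_mul_C_inv {F : Type*} [Field F] {a b c : F} (ha : a ≠ 0) :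
    ((C a * X ^ 2 + C b * X + C c) * C a⁻¹).Monic ∧
      ((C a * X ^ 2 + C b * X + C c) * C a⁻¹).natDegree = 2 := by
  constructor
  · have := monic_mul_leadingCoeff_inv (p := C a * X ^ 2 + C b * X + C c) (by
      intro h0
      have := natDegree_quadratic (b := b) (c := c) ha
      rw [h0] at this
      simp at this)
    rwa [leadingCoeff_quadratic ha] at this
  · rw [natDegree_mul_C (inv_ne_zero ha), natDegree_quadratic ha]

lemma monicSum_resultantWeight_quadratic (hψ : ψ ≠ 1) (ha : a ≠ 0)
    (hdisc : b ^ 2 - 4 * a * c ≠ 0) {n : ℕ} (hn : 2 ≤ n) :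
    monicSum (resultantWeight ψ (C a * X ^ 2 + C b * X + C c) 2) n = 0 := by
  obtain ⟨k, rfl⟩ := Nat.exists_eq_add_of_le' hn
  obtain ⟨h1, h2⟩ := monic_quadratic_mul_C_inv (b := b) (c := c) ha
  rw [monicSum, sum_monicsOfDegree_add_two h1 h2]
  refine Finset.sum_eq_zero fun p hp => ?_
  simp_rw [resultantWeight_linear_add_mul_quadratic ha _ _ hp, ← Finset.mul_sum]
  rw [sum_mulChar_quadraticForm hψ ha hdisc, mul_zero]

lemma monicSum_resultantWeight_X_mul_quadratic (hχ : χ ≠ 1) (hψ : ψ ≠ 1) (ha : a ≠ 0)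
    (hdisc : b ^ 2 - 4 * a * c ≠ 0) {n : ℕ} (hn : 3 ≤ n) :
    monicSum (fun f => resultantWeight χ X 1 f *
      resultantWeight ψ (C a * X ^ 2 + C b * X + C c) 2 f) n = 0 := by
  obtain ⟨k, rfl⟩ := Nat.exists_eq_add_of_le' (by omega : 2 ≤ n)
  have hk : 0 < k := by omega
  obtain ⟨h1, h2⟩ := monic_quadratic_mul_C_inv (b := b) (c := c) ha
  rw [monicSum, sum_monicsOfDegree_add_two h1 h2]
  have hX : ∀ f : F[X], resultantWeight χ X 1 f = χ ((-1) ^ f.natDegree) * χ (f.eval 0) := by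
    intro f
    have := resultant_X_sub_C_right f f.natDegree 0 le_rfl
    rw [map_zero, sub_zero] at this
    rw [resultantWeight, this, map_mul]
  have hterm : ∀ p ∈ monicsOfDegree F k, ∀ u v : F,
      resultantWeight χ X 1 (C u * X + C v + (C a * X ^ 2 + C b * X + C c) * C a⁻¹ * p) *
      resultantWeight ψ (C a * X ^ 2 + C b * X + C c) 2
        (C u * X + C v + (C a * X ^ 2 + C b * X + C c) * C a⁻¹ * p) =
      χ ((-1) ^ (k + 2)) * ψ (a ^ (k + 1)) * (χ (c * a⁻¹ * p.eval 0 + v) *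
        ψ (a * v ^ 2 - b * u * v + c * u ^ 2)) := by
    intro p hp u v
    have hp' := mem_monicsOfDegree.1 hp
    have hdeg : (C u * X + C v + (C a * X ^ 2 + C b * X + C c) * C a⁻¹ * p).natDegree = k + 2 := by
      have hgp : ((C a * X ^ 2 + C b * X + C c) * C a⁻¹ * p).natDegree = k + 2 := by
        rw [h1.natDegree_mul hp'.1, h2, hp'.2, add_comm]
      rw [natDegree_add_eq_right_of_natDegree_lt, hgp]
      rw [hgp]
      exact natDegree_linear_le.trans_lt (by omega)
    rw [resultantWeight_linear_add_mul_quadratic ha _ _ hp, hX, hdeg]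
    have he : (C u * X + C v + (C a * X ^ 2 + C b * X + C c) * C a⁻¹ * p).eval 0 =
        c * a⁻¹ * p.eval 0 + v := by
      simp; ring
    rw [he]
    ring
  rw [Finset.sum_congr rfl fun p hp => Finset.sum_congr rfl fun u _ =>
    Finset.sum_congr rfl fun v _ => hterm p hp u v]
  simp_rw [← Finset.mul_sum]
  rw [mul_eq_zero]; right
  by_cases hc : c = 0
  · have hb : b ≠ 0 := by rintro rfl; simp [hc] at hdisc
    refine Finset.sum_eq_zero fun p _ => ?_
    rw [Finset.sum_comm]
    refine Finset.sum_eq_zero fun v _ => ?_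
    by_cases hv : v = 0
    · simp [hc, hv, MulChar.map_zero]
    · rw [← Finset.mul_sum, mul_eq_zero]; right
      rw [← MulChar.sum_eq_zero_of_ne_one hψ]
      refine Fintype.sum_equiv ((Equiv.mulLeft₀ (-(b * v)) (by simp [hb, hv])).trans
        (Equiv.addLeft (a * v ^ 2))) _ _ fun u => ?_
      congr 1
      simp only [hc, Equiv.trans_apply, Equiv.mulLeft₀_apply, Equiv.coe_addLeft]
      ring
  · rw [Finset.sum_comm]
    refine Finset.sum_eq_zero fun u _ => ?_
    rw [Finset.sum_comm]
    refine Finset.sum_eq_zero fun v _ => ?_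
    rw [← Finset.sum_mul, sum_eval_zero_monicsOfDegree hk hχ (mul_ne_zero hc (inv_ne_zero ha)),
      zero_mul]

lemma exists_extension_card_eq (F : Type*) [Field F] [Fintype F] {n : ℕ} (hn : 0 < n) :
    ∃ (L : Type) (_ : Field L) (_ : Fintype L) (_ : Algebra F L),
      Module.finrank F L = 2 * n ∧ Fintype.card L = (Fintype.card F ^ n) ^ 2 := by
  obtain ⟨p, hp⟩ := CharP.exists F
  have : Fact p.Prime := ⟨CharP.char_is_prime F p⟩
  have : NeZero (2 * n) := ⟨by omega⟩
  have : Finite (FiniteField.Extension F p (2 * n)) := Module.finite_of_finite F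
  let _ : Fintype (FiniteField.Extension F p (2 * n)) := Fintype.ofFinite _
  refine ⟨FiniteField.Extension F p (2 * n), inferInstance, inferInstance, inferInstance,
    FiniteField.finrank_extension F p (2 * n), ?_⟩
  rw [← Nat.card_eq_fintype_card, FiniteField.natCard_extension, Nat.card_eq_fintype_card,
    ← pow_mul, mul_comm]

lemma map_disc_ne_zero {F L : Type*} [Field F] [Field L] [Algebra F L] {a b c : F}
    (hdisc : b ^ 2 - 4 * a * c ≠ 0) :
    algebraMap F L b ^ 2 - 4 * algebraMap F L a * algebraMap F L c ≠ 0 := by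
  have h := (map_ne_zero (algebraMap F L)).2 hdisc
  rwa [map_sub, map_mul, map_mul, map_pow, map_ofNat] at h

variable (a b c)

lemma primePowerSum_resultantWeight_quadratic (ψ : MulChar F ℂ) (L : Type*) [Field L] [Fintype L]
    [Algebra F L] :
    primePowerSum (resultantWeight ψ (C a * X ^ 2 + C b * X + C c) 2) (Module.finrank F L) =
      ∑ x : L, ψ (Algebra.norm F
        (algebraMap F L a * x ^ 2 + algebraMap F L b * x + algebraMap F L c)) := by
  rw [primePowerSum_finrank]
  refine Finset.sum_congr rfl fun x _ => ?_
  rw [resultantWeight_minpoly_pow _ natDegree_quadratic_le]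
  simp

lemma primePowerSum_resultantWeight_X_mul_quadratic (χ ψ : MulChar F ℂ) (L : Type*) [Field L]
    [Fintype L] [Algebra F L] :
    primePowerSum (fun f => resultantWeight χ X 1 f *
      resultantWeight ψ (C a * X ^ 2 + C b * X + C c) 2 f) (Module.finrank F L) =
      ∑ x : L, χ (Algebra.norm F x) * ψ (Algebra.norm F
        (algebraMap F L a * x ^ 2 + algebraMap F L b * x + algebraMap F L c)) := by
  rw [primePowerSum_finrank]
  refine Finset.sum_congr rfl fun x _ => ?_
  rw [mul_pow, resultantWeight_minpoly_pow _ natDegree_X_le,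
    resultantWeight_minpoly_pow _ natDegree_quadratic_le]
  simp

variable {a b c}

theorem norm_sum_mulChar_mul_quadratic_le (hχ : χ ≠ 1) (hψ : ψ ≠ 1) (ha : a ≠ 0)
    (hdisc : b ^ 2 - 4 * a * c ≠ 0) :
    ‖∑ x : F, χ x * ψ (a * x ^ 2 + b * x + c)‖ ≤ 2 * √(Fintype.card F) := by
  have h1 := primePowerSum_resultantWeight_X_mul_quadratic a b c χ ψ F
  simp only [Module.finrank_self, Algebra.norm_self, MonoidHom.id_apply,
    Algebra.algebraMap_self_apply] at h1
  rw [← h1]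
  set Ψ : F[X] → ℂ := fun f => resultantWeight χ X 1 f *
    resultantWeight ψ (C a * X ^ 2 + C b * X + C c) 2 f with hΨ
  have hone : Ψ 1 = 1 := by simp [hΨ, resultantWeight_one]
  have hmul : ∀ f g : F[X], f.Monic → g.Monic → Ψ (f * g) = Ψ f * Ψ g := by
    intro f g hf hg
    simp only [hΨ]
    rw [resultantWeight_mul _ natDegree_X_le hf hg,
      resultantWeight_mul _ natDegree_quadratic_le hf hg]
    ring
  refine norm_le_two_mul_sqrt (monicSum_zero Ψ hone) (natCast_mul_monicSum hone hmul)
    (fun n hn => monicSum_resultantWeight_X_mul_quadratic hχ hψ ha hdisc hn)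
    (C := 10 * Fintype.card F ^ 2 + 1) (by exact_mod_cast Fintype.card_pos) fun n hn => ?_
  obtain ⟨L, _, _, _, hL, hcard⟩ := exists_extension_card_eq F hn
  rw [← hL, primePowerSum_resultantWeight_X_mul_quadratic]
  exact norm_sum_mulChar_norm_mul_quadratic_le hn hcard χ hψ (by simpa using ha)
    (map_disc_ne_zero hdisc)

theorem norm_sum_mulChar_quadratic_le (hψ : ψ ≠ 1) (ha : a ≠ 0) (hdisc : b ^ 2 - 4 * a * c ≠ 0) :
    ‖∑ x : F, ψ (a * x ^ 2 + b * x + c)‖ ≤ √(Fintype.card F) := by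
  have h1 := primePowerSum_resultantWeight_quadratic a b c ψ F
  simp only [Module.finrank_self, Algebra.norm_self, MonoidHom.id_apply,
    Algebra.algebraMap_self_apply] at h1
  rw [← h1]
  refine norm_le_sqrt (monicSum_zero _ (resultantWeight_one ψ))
    (natCast_mul_monicSum (resultantWeight_one ψ) fun f g hf hg =>
      resultantWeight_mul _ natDegree_quadratic_le hf hg)
    (fun n hn => monicSum_resultantWeight_quadratic hψ ha hdisc (by omega))
    (C := 10 * Fintype.card F ^ 2 + 2) (by exact_mod_cast Fintype.card_pos)
    (monicSum_resultantWeight_quadratic hψ ha hdisc le_rfl) fun n hn => ?_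
  obtain ⟨L, _, _, _, hL, hcard⟩ := exists_extension_card_eq F hn
  rw [← hL, primePowerSum_resultantWeight_quadratic]
  exact norm_sum_mulChar_norm_quadratic_le' hn hcard hψ (by simpa using ha)
    (map_disc_ne_zero hdisc)

end CharacterSums

section Sieve

variable {F : Type*} [Field F] [Fintype F]

lemma exists_pow_eq_of_mulChar_eq_one {p : ℕ} {ψ : MulChar F ℂ} (hψ : orderOf ψ = p) {g : F}
    (hg : ψ g = 1) : ∃ h : F, g = h ^ p := by
  have hg0 : g ≠ 0 := by
    rintro rfl
    exact zero_ne_one ((MulChar.map_zero ψ).symm.trans hg)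
  obtain ⟨u, hu⟩ := IsCyclic.exists_generator (α := Fˣ)
  obtain ⟨k, hk : u ^ k = Units.mk0 g hg0⟩ := mem_powers_iff_mem_zpowers.2 (hu (Units.mk0 g hg0))
  have hgk : g = (u : F) ^ k := by
    rw [← Units.val_pow_eq_pow_val, hk, Units.val_mk0]
  have h1 : ψ ^ k = 1 := by
    rw [MulChar.eq_iff hu, MulChar.pow_apply_coe, MulChar.one_apply_coe, ← map_pow, ← hgk, hg]
  obtain ⟨m, rfl⟩ := hψ ▸ orderOf_dvd_of_pow_eq_one h1
  exact ⟨(u : F) ^ m, by rw [hgk, pow_mul']⟩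

lemma mulChar_pow_apply_eq_one {F : Type*} [Field F] {p : ℕ} {ψ : MulChar F ℂ} (hψ : orderOf ψ = p)
    {h : F}
    (hh : h ≠ 0) : ψ (h ^ p) = 1 := by
  obtain ⟨u, rfl⟩ := isUnit_iff_ne_zero.2 hh
  rw [map_pow, ← MulChar.pow_apply_coe, ← hψ, pow_orderOf_eq_one, MulChar.one_apply_coe]

lemma sum_range_mulChar_pow {p : ℕ} (hp : p.Prime) {ψ : MulChar F ℂ} (hψ : orderOf ψ = p) {g : F}
    (hg : g ≠ 0) [Decidable (∃ h : F, g = h ^ p)] :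
    ∑ i ∈ Finset.range p, (ψ ^ i) g = if ∃ h : F, g = h ^ p then (p : ℂ) else 0 := by
  have hpow : ∀ i, (ψ ^ i) g = ψ g ^ i := by
    intro i
    obtain ⟨u, rfl⟩ := isUnit_iff_ne_zero.2 hg
    exact MulChar.pow_apply_coe ψ i u
  simp_rw [hpow]
  split_ifs with h
  · obtain ⟨h, rfl⟩ := h
    have hh : h ≠ 0 := by
      rintro rfl
      exact hg (zero_pow hp.ne_zero)
    simp [mulChar_pow_apply_eq_one hψ hh]
  · have h1 : ψ g ≠ 1 := fun h1 => h (exists_pow_eq_of_mulChar_eq_one hψ h1)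
    rw [geom_sum_eq h1, ← map_pow, mulChar_pow_apply_eq_one hψ hg, sub_self, zero_div]

/-- The coefficients of the powers of a character of prime order `p` in the expansion of the
indicator function of the nonzero elements which are not `p`-th powers. -/
noncomputable def primeFreeCoeff (p i : ℕ) : ℝ := if i = 0 then 1 else -1 / ((p : ℝ) - 1)

lemma sum_primeFreeCoeff_mul {p : ℕ} (hp : p.Prime) (f : ℕ → ℂ) :
    ((1 - 1 / (p : ℝ) : ℝ) : ℂ) * ∑ i ∈ Finset.range p, primeFreeCoeff p i * f i =
      f 0 - 1 / p * ∑ i ∈ Finset.range p, f i := by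
  obtain ⟨k, rfl⟩ := Nat.exists_eq_succ_of_ne_zero hp.ne_zero
  have hk : (k : ℂ) ≠ 0 := by
    have := hp.two_le
    exact_mod_cast (by omega : k ≠ 0)
  have hk1 : (k : ℂ) + 1 ≠ 0 := by exact_mod_cast k.succ_ne_zero
  rw [Finset.sum_range_succ', Finset.sum_range_succ']
  simp only [primeFreeCoeff, Nat.succ_ne_zero, if_false, if_true]
  rw [← Finset.mul_sum]
  push_cast
  simp only [add_sub_cancel_right]
  field_simp
  ring

lemma sum_abs_primeFreeCoeff {p : ℕ} (hp : p.Prime) :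
    ∑ i ∈ Finset.range p, |primeFreeCoeff p i| = 2 := by
  obtain ⟨k, rfl⟩ := Nat.exists_eq_succ_of_ne_zero hp.ne_zero
  have hk : (0 : ℝ) < k := by
    have := hp.two_le
    exact_mod_cast (by omega : 0 < k)
  rw [Finset.sum_range_succ']
  simp only [primeFreeCoeff, Nat.add_eq_zero_iff, one_ne_zero, and_false, if_false, if_true,
    Nat.succ_eq_add_one, Finset.sum_const, Finset.card_range, nsmul_eq_mul]
  push_cast
  rw [add_sub_cancel_right, abs_div, abs_neg, abs_one, abs_of_pos hk]
  field_simp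
  norm_num

open scoped Classical in
theorem exists_mulChar_expansion_of_primes [Fintype (MulChar F ℂ)] (s : Finset ℕ)
    (hs : ∀ p ∈ s, p.Prime ∧ p ∣ Fintype.card F - 1) :
    ∃ w : MulChar F ℂ → ℝ, w 1 = 1 ∧ (∀ χ, w χ ≠ 0 → χ ^ (∏ p ∈ s, p) = 1) ∧
      ∑ χ, |w χ| ≤ 2 ^ s.card ∧
      ∀ g : F, (if g ≠ 0 ∧ ∀ p ∈ s, ¬ ∃ h : F, g = h ^ p then (1 : ℂ) else 0) =
        ((∏ p ∈ s, (1 - 1 / (p : ℝ)) : ℝ) : ℂ) * ∑ χ, w χ * χ g := by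
  induction s using Finset.induction_on with
  | empty =>
    refine ⟨fun χ => if χ = 1 then 1 else 0, by simp, by simp, ?_, fun g => ?_⟩
    · rw [Finset.sum_eq_single 1] <;> simp +contextual
    · rw [Finset.sum_eq_single 1] <;> simp +contextual
      by_cases hg : g = 0
      · simp [hg, MulChar.map_zero]
      · simp [hg, MulChar.one_apply (isUnit_iff_ne_zero.2 hg)]
  | insert p s hps ih =>
    obtain ⟨w, hw1, hw, hsum, hind⟩ := ih fun r hr => hs r (Finset.mem_insert_of_mem hr)
    obtain ⟨hp, hpq⟩ := hs p (Finset.mem_insert_self p s)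
    obtain ⟨ψ, hψ⟩ := MulChar.exists_mulChar_orderOf F hpq
      (Complex.isPrimitiveRoot_exp p hp.ne_zero)
    have hcop : Nat.Coprime p (∏ r ∈ s, r) := Nat.Coprime.prod_right fun r hr =>
      (Nat.coprime_primes hp (hs r (Finset.mem_insert_of_mem hr)).1).2 fun h => hps (h ▸ hr)
    refine ⟨fun χ => ∑ i ∈ Finset.range p, primeFreeCoeff p i * w (χ * (ψ ^ i)⁻¹), ?_, ?_, ?_, ?_⟩
    · simp only
      rw [Finset.sum_eq_single 0]
      · simp [primeFreeCoeff, hw1]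
      · intro i hi hi0
        by_contra hne
        have h1 := hw _ (right_ne_zero_of_mul hne)
        rw [one_mul, inv_pow, inv_eq_one, ← pow_mul] at h1
        have h2 := hcop.dvd_of_dvd_mul_right (hψ ▸ orderOf_dvd_of_pow_eq_one h1)
        exact absurd (Nat.le_of_dvd (Nat.pos_of_ne_zero hi0) h2)
          (not_le.2 (Finset.mem_range.1 hi))
      · intro h
        exact absurd (Finset.mem_range.2 hp.pos) h
    · intro χ hχ
      obtain ⟨i, -, hi⟩ := Finset.exists_ne_zero_of_sum_ne_zero hχ
      have h1 := hw _ (right_ne_zero_of_mul hi)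
      have h2 : (ψ ^ i) ^ p = 1 := by
        rw [pow_right_comm, ← hψ, pow_orderOf_eq_one, one_pow]
      rw [← mul_inv_cancel_right χ (ψ ^ i)⁻¹, inv_inv, mul_pow, Finset.prod_insert hps, pow_mul',
        h1, one_pow, one_mul, pow_mul, h2, one_pow]
    · rw [Finset.card_insert_of_notMem hps, pow_succ']
      calc ∑ χ, |∑ i ∈ Finset.range p, primeFreeCoeff p i * w (χ * (ψ ^ i)⁻¹)|
          ≤ ∑ χ, ∑ i ∈ Finset.range p, |primeFreeCoeff p i| * |w (χ * (ψ ^ i)⁻¹)| :=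
            Finset.sum_le_sum fun χ _ => (Finset.abs_sum_le_sum_abs _ _).trans
              (Finset.sum_le_sum fun i _ => (abs_mul _ _).le)
        _ = ∑ i ∈ Finset.range p, |primeFreeCoeff p i| * ∑ χ, |w χ| := by
            rw [Finset.sum_comm]
            refine Finset.sum_congr rfl fun i _ => ?_
            rw [← Finset.mul_sum]
            congr 1
            exact Fintype.sum_equiv (Equiv.mulRight (ψ ^ i)⁻¹) _ _ fun χ => rfl
        _ = 2 * ∑ χ, |w χ| := by rw [← Finset.sum_mul, sum_abs_primeFreeCoeff hp]
        _ ≤ 2 * 2 ^ s.card := by gcongr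
    · intro g
      have h1 : ∑ χ : MulChar F ℂ, ((∑ i ∈ Finset.range p,
          primeFreeCoeff p i * w (χ * (ψ ^ i)⁻¹) : ℝ) : ℂ) * χ g =
          (∑ χ, w χ * χ g) * ∑ i ∈ Finset.range p, primeFreeCoeff p i * (ψ ^ i) g := by
        push_cast
        simp_rw [Finset.sum_mul, Finset.mul_sum]
        rw [Finset.sum_comm, Finset.sum_comm (s := Finset.univ)]
        refine Finset.sum_congr rfl fun i _ => ?_
        refine Fintype.sum_equiv (Equiv.mulRight (ψ ^ i)⁻¹) _ _ fun χ => ?_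
        rw [Equiv.coe_mulRight]
        nth_rewrite 2 [← inv_mul_cancel_right χ (ψ ^ i)]
        rw [MulChar.mul_apply]
        ring
      rw [h1, Finset.prod_insert hps, Complex.ofReal_mul]
      rw [show ∀ x y z t : ℂ, x * y * (z * t) = (y * z) * (x * t) by intros; ring, ← hind,
        sum_primeFreeCoeff_mul hp]
      by_cases hg : g = 0
      · simp [hg]
      · rw [sum_range_mulChar_pow hp hψ hg, pow_zero, MulChar.one_apply (isUnit_iff_ne_zero.2 hg)]
        have hp0 : (p : ℂ) ≠ 0 := by exact_mod_cast hp.ne_zero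
        by_cases hgp : ∃ h : F, g = h ^ p
        · rw [if_pos hgp, if_neg fun h => h.2 p (Finset.mem_insert_self p s) hgp]
          field_simp
          simp
        · simp [not_exists.1 hgp, hg]

end Sieve

section Count

variable {F : Type*} [Field F] [Fintype F] {a b c : F}

lemma eFree_iff {e : ℕ} (he : e ≠ 0) {g : F} :
    EFree e g ↔ g ≠ 0 ∧ ∀ p ∈ e.primeFactors, ¬ ∃ h : F, g = h ^ p := by
  refine and_congr_right fun _ => ⟨fun h p hp hg => ?_, fun h d hd => ?_⟩
  · exact (Nat.prime_of_mem_primeFactors hp).ne_one (h p (Nat.dvd_of_mem_primeFactors hp) hg)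
  · rintro ⟨x, rfl⟩
    by_contra hd1
    obtain ⟨p, hp, m, rfl⟩ := Nat.exists_prime_and_dvd hd1
    exact h p (Nat.mem_primeFactors.2 ⟨hp, (dvd_mul_right p m).trans hd, he⟩)
      ⟨x ^ m, pow_mul' x p m⟩

open scoped Classical in
lemma card_filter_quadratic_eq_zero_le (ha : a ≠ 0) :
    (Finset.univ.filter fun x : F => a * x ^ 2 + b * x + c = 0).card ≤ 2 := by
  have h0 : C a * X ^ 2 + C b * X + C c ≠ 0 := fun h => by
    simpa [h] using natDegree_quadratic (b := b) (c := c) ha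
  calc (Finset.univ.filter fun x : F => a * x ^ 2 + b * x + c = 0).card
      ≤ (C a * X ^ 2 + C b * X + C c).roots.toFinset.card := by
        refine Finset.card_le_card fun x hx => ?_
        simpa [h0] using hx
    _ ≤ 2 := (Multiset.toFinset_card_le _).trans ((card_roots' _).trans natDegree_quadratic_le)

lemma norm_sum_mulChar_mul_one_quadratic_le {χ : MulChar F ℂ} (hχ : χ ≠ 1) (ha : a ≠ 0) :
    ‖∑ x : F, χ x * (1 : MulChar F ℂ) (a * x ^ 2 + b * x + c)‖ ≤ 2 := by
  classical
  have h : ∑ x : F, χ x * (1 : MulChar F ℂ) (a * x ^ 2 + b * x + c) =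
      - ∑ x : F with a * x ^ 2 + b * x + c = 0, χ x := by
    rw [eq_neg_iff_add_eq_zero, ← MulChar.sum_eq_zero_of_ne_one hχ, Finset.sum_filter,
      ← Finset.sum_add_distrib]
    refine Finset.sum_congr rfl fun x _ => ?_
    split_ifs with h0
    · rw [h0, MulChar.map_zero, mul_zero, zero_add]
    · rw [MulChar.one_apply (isUnit_iff_ne_zero.2 h0), mul_one, add_zero]
  rw [h, norm_neg]
  calc ‖∑ x : F with a * x ^ 2 + b * x + c = 0, χ x‖
      ≤ ∑ x : F with a * x ^ 2 + b * x + c = 0, 1 :=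
        norm_sum_le_of_le _ fun x _ => norm_mulChar_le_one χ x
    _ ≤ 2 := by
      rw [Finset.sum_const, nsmul_eq_mul, mul_one]
      exact_mod_cast card_filter_quadratic_eq_zero_le ha

lemma norm_sum_one_mul_mulChar_quadratic_le {ψ : MulChar F ℂ} (hψ : ψ ≠ 1) (ha : a ≠ 0)
    (hdisc : b ^ 2 - 4 * a * c ≠ 0) :
    ‖∑ x : F, (1 : MulChar F ℂ) x * ψ (a * x ^ 2 + b * x + c)‖ ≤ √(Fintype.card F) + 1 := by
  classical
  have h : ∑ x : F, (1 : MulChar F ℂ) x * ψ (a * x ^ 2 + b * x + c) =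
      ∑ x : F, ψ (a * x ^ 2 + b * x + c) - ψ c := by
    rw [eq_sub_iff_add_eq, ← Finset.add_sum_erase _ _ (Finset.mem_univ (0 : F)),
      ← Finset.add_sum_erase (a := (0 : F)) _ (fun x => ψ (a * x ^ 2 + b * x + c))
        (Finset.mem_univ 0)]
    rw [Finset.sum_congr (g := fun x => ψ (a * x ^ 2 + b * x + c)) rfl fun x hx => by
      rw [MulChar.one_apply (isUnit_iff_ne_zero.2 (Finset.ne_of_mem_erase hx)), one_mul]]
    rw [MulChar.map_zero, zero_mul, zero_add, add_comm]
    simp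
  rw [h]
  exact (norm_sub_le _ _).trans
    (add_le_add (norm_sum_mulChar_quadratic_le hψ ha hdisc) (norm_mulChar_le_one ψ c))

lemma card_sub_three_le_re_sum_one_mul_one (ha : a ≠ 0) :
    (Fintype.card F : ℝ) - 3 ≤
      (∑ x : F, (1 : MulChar F ℂ) x * (1 : MulChar F ℂ) (a * x ^ 2 + b * x + c)).re := by
  classical
  set Z := insert (0 : F) (Finset.univ.filter fun x : F => a * x ^ 2 + b * x + c = 0) with hZ
  have hcard : Z.card ≤ 3 := (Finset.card_insert_le _ _).trans
    (Nat.succ_le_succ (card_filter_quadratic_eq_zero_le ha))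
  have h : ∑ x : F, (1 : MulChar F ℂ) x * (1 : MulChar F ℂ) (a * x ^ 2 + b * x + c) =
      (Zᶜ.card : ℂ) := by
    rw [Finset.card_eq_sum_ones, Nat.cast_sum, ← Finset.sum_subset (Finset.subset_univ Zᶜ)]
    · refine Finset.sum_congr rfl fun x hx => ?_
      simp only [hZ, Finset.mem_compl, Finset.mem_insert, Finset.mem_filter, Finset.mem_univ,
        true_and, not_or] at hx
      rw [MulChar.one_apply (isUnit_iff_ne_zero.2 hx.1),
        MulChar.one_apply (isUnit_iff_ne_zero.2 hx.2), mul_one, Nat.cast_one]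
    · intro x _ hx
      simp only [hZ, Finset.mem_compl, Finset.mem_insert, Finset.mem_filter, Finset.mem_univ,
        true_and, not_not] at hx
      rcases hx with rfl | hx
      · rw [MulChar.map_zero, zero_mul]
      · rw [hx, MulChar.map_zero, mul_zero]
  rw [h, Complex.natCast_re]
  have h1 : Z.card + Zᶜ.card = Fintype.card F := Finset.card_add_card_compl Z
  have h2 : Fintype.card F ≤ Zᶜ.card + 3 := by omega
  rw [sub_le_iff_le_add]
  exact_mod_cast h2

/-- A weighted double sum dominated, away from a distinguished pair of indices, by bounds which
depend only on which of the two indices are distinguished. -/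
lemma sub_le_re_sum_sum {ι : Type*} [Fintype ι] (i₀ : ι) {w : ι → ℝ}
    (hw : w i₀ = 1) {K : ℝ} (hK : ∑ i, |w i| ≤ K) {S : ι → ι → ℂ} {m A B D : ℝ} (hA : 0 ≤ A)
    (hB : 0 ≤ B) (hD : 0 ≤ D) (hS : m ≤ (S i₀ i₀).re) (hS₁ : ∀ i ≠ i₀, ‖S i i₀‖ ≤ A)
    (hS₂ : ∀ j ≠ i₀, ‖S i₀ j‖ ≤ B) (hS₃ : ∀ i ≠ i₀, ∀ j ≠ i₀, ‖S i j‖ ≤ D) :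
    m - A * (K - 1) - B * (K - 1) - D * (K - 1) ^ 2 ≤
      (∑ i, ∑ j, (w i : ℂ) * w j * S i j).re := by
  classical
  set E := Finset.univ.erase i₀ with hE
  have hne : ∀ i ∈ E, i ≠ i₀ := fun i hi => Finset.ne_of_mem_erase hi
  set k := ∑ i ∈ E, |w i| with hk
  have hk0 : 0 ≤ k := Finset.sum_nonneg fun i _ => abs_nonneg _
  have hkK : k ≤ K - 1 := by
    rw [← Finset.add_sum_erase _ _ (Finset.mem_univ i₀), hw, abs_one] at hK
    linarith
  have hrow : ∀ (f : ι → ℂ) (M : ℝ), (∀ i ∈ E, ‖f i‖ ≤ M) → ‖∑ i ∈ E, w i * f i‖ ≤ k * M := by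
    intro f M hf
    rw [hk, Finset.sum_mul]
    refine norm_sum_le_of_le _ fun i hi => ?_
    rw [norm_mul, Complex.norm_real, Real.norm_eq_abs]
    exact mul_le_mul_of_nonneg_left (hf i hi) (abs_nonneg _)
  have hsplit : ∑ i, ∑ j, (w i : ℂ) * w j * S i j = S i₀ i₀ + ∑ i ∈ E, w i * S i i₀ +
      ∑ j ∈ E, w j * S i₀ j + ∑ i ∈ E, w i * ∑ j ∈ E, w j * S i j := by
    have h : ∀ i, ∑ j, (w i : ℂ) * w j * S i j =
        w i * S i i₀ + w i * ∑ j ∈ E, w j * S i j := by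
      intro i
      rw [← Finset.add_sum_erase _ _ (Finset.mem_univ i₀), hw, Finset.mul_sum, Complex.ofReal_one,
        mul_one]
      simp only [mul_assoc, hE]
    simp_rw [h]
    rw [Finset.sum_add_distrib, ← Finset.add_sum_erase _ _ (Finset.mem_univ i₀),
      ← Finset.add_sum_erase _ (fun i => (w i : ℂ) * ∑ j ∈ E, w j * S i j) (Finset.mem_univ i₀), hw,
      Complex.ofReal_one, one_mul, one_mul]
    ring
  have h1 := (Complex.abs_re_le_norm _).trans
    (hrow (fun i => S i i₀) A fun i hi => hS₁ i (hne i hi))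
  have h2 := (Complex.abs_re_le_norm _).trans (hrow (S i₀) B fun i hi => hS₂ i (hne i hi))
  have h3 := (Complex.abs_re_le_norm _).trans (hrow (fun i => ∑ j ∈ E, w j * S i j) (k * D)
    fun i hi => hrow (S i) D fun j hj => hS₃ i (hne i hi) j (hne j hj))
  have h1' := mul_le_mul_of_nonneg_right hkK hA
  have h2' := mul_le_mul_of_nonneg_right hkK hB
  have h3' : k * (k * D) ≤ (K - 1) * ((K - 1) * D) := by gcongr; exact hk0.trans hkK
  rw [hsplit, Complex.add_re, Complex.add_re, Complex.add_re]
  linarith [neg_le_of_abs_le h1, neg_le_of_abs_le h2, neg_le_of_abs_le h3]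

open scoped Classical in
lemma natCast_NN (e : ℕ) : (NN a b c e e : ℂ) = ∑ x : F,
    (if EFree e x then 1 else 0) * (if EFree e (a * x ^ 2 + b * x + c) then 1 else 0) := by
  simp_rw [ite_zero_mul_ite_zero, mul_one]
  rw [Finset.sum_boole, NN, Set.ncard_eq_toFinset_card']
  simp

end Count

/-- **Lemma 2.** If the triple `(a,b,c)` satisfies `a ≠ 0`, `b² − 4ac ≠ 0`,
and `e ∣ q − 1` (with `e` even if `q` is odd), then
`N(e,e) ≥ θ(e)²·(q − 2·W(e)·√q·(W(e) − 3/2 + 1/(2W(e))) − 3·W(e))`. -/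
theorem stmt_3 (F : Type*) [Field F] [Fintype F]
    (a b c : F) (ha : a ≠ 0) (hdisc : b ^ 2 - 4 * a * c ≠ 0)
    (e : ℕ) (he : e ∣ Fintype.card F - 1)
    (heven : Odd (Fintype.card F) → Even e) :
    θ e ^ 2 * ((Fintype.card F : ℝ) -
        2 * (W e : ℝ) * Real.sqrt (Fintype.card F) *
          ((W e : ℝ) - 3 / 2 + 1 / (2 * (W e : ℝ))) -
        3 * (W e : ℝ)) ≤ (NN a b c e e : ℝ) := by
  classical
  have : Fintype (MulChar F ℂ) := Fintype.ofFinite _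
  have hcard : 1 < Fintype.card F := Fintype.one_lt_card
  have he0 : e ≠ 0 := ne_zero_of_dvd_ne_zero (by omega) he
  obtain ⟨w, hw1, -, hsum, hind⟩ := exists_mulChar_expansion_of_primes (F := F) e.primeFactors
    fun p hp => ⟨Nat.prime_of_mem_primeFactors hp, (Nat.dvd_of_mem_primeFactors hp).trans he⟩
  have hsum' : ∑ χ, |w χ| ≤ (W e : ℝ) := by
    rw [W]
    exact_mod_cast hsum
  have hbound := sub_le_re_sum_sum 1 hw1 hsum'
    (S := fun χ ψ => ∑ x : F, χ x * ψ (a * x ^ 2 + b * x + c)) zero_le_two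
    (by positivity : 0 ≤ √(Fintype.card F) + 1) (by positivity : 0 ≤ 2 * √(Fintype.card F))
    (card_sub_three_le_re_sum_one_mul_one ha)
    (fun χ hχ => norm_sum_mulChar_mul_one_quadratic_le hχ ha)
    (fun ψ hψ => norm_sum_one_mul_mulChar_quadratic_le hψ ha hdisc)
    (fun χ hχ ψ hψ => norm_sum_mulChar_mul_quadratic_le hχ hψ ha hdisc)
  have hN : (NN a b c e e : ℂ) = (θ e ^ 2 : ℝ) * ∑ χ : MulChar F ℂ, ∑ ψ : MulChar F ℂ,
      (w χ : ℂ) * w ψ * ∑ x : F, χ x * ψ (a * x ^ 2 + b * x + c) := by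
    rw [natCast_NN]
    simp_rw [eFree_iff he0, hind, ← θ.eq_1]
    simp_rw [Finset.mul_sum, Finset.sum_mul]
    rw [Finset.sum_comm]
    refine Eq.trans ?_ Finset.sum_comm
    refine Finset.sum_congr rfl fun ψ _ => ?_
    rw [Finset.sum_comm]
    refine Finset.sum_congr rfl fun χ _ => Finset.sum_congr rfl fun x _ => ?_
    push_cast
    ring
  have hN' : (NN a b c e e : ℝ) = θ e ^ 2 * (∑ χ : MulChar F ℂ, ∑ ψ : MulChar F ℂ,
      (w χ : ℂ) * w ψ * ∑ x : F, χ x * ψ (a * x ^ 2 + b * x + c)).re := by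
    rw [← Complex.re_ofReal_mul, ← hN, Complex.natCast_re]
  rw [hN']
  refine mul_le_mul_of_nonneg_left (le_of_eq_of_le ?_ hbound) (sq_nonneg _)
  have hW : (W e : ℝ) ≠ 0 := by simp [W]
  field_simp
  ring
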